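/- arXiv:2602.15347 — 5 statements merged into one kernel-verified Lean document; each statement's English description precedes it below -/
import Mathlib

section
/- Let d ≥ 2 and let C be the set of vertices of a d-dimensional convex polytope in E^d with |C| = n ≥ d+1. If S ⊆ C satisfies V_S ≠ ∅ and conv(S) ⊆ bd(conv(C)), then V_S is unbounded. -/
open Metric Set
open scoped RealInnerProductSpace

/-- The dimension of a set: the dimension of its affine span. -/
noncomputable def setDim {d : ℕ} (A : Set (EuclideanSpace ℝ (Fin d))) : ℕ :=
  Module.finrank ℝ (affineSpan ℝ A).direction

/-- The farthest-point Voronoi face `V_S`: the set of points whose set of farthest points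
of `C` is exactly `S`. -/
def vorF {d : ℕ} (C S : Set (EuclideanSpace ℝ (Fin d))) : Set (EuclideanSpace ℝ (Fin d)) :=
  {x | S = {c | c ∈ C ∧ ∀ c' ∈ C, dist x c' ≤ dist x c}}

/-- `P_{C,r}`: the intersection of the closed balls of radius `r` centered at points of `C`. -/
def ballPoly {d : ℕ} (C : Set (EuclideanSpace ℝ (Fin d))) (r : ℝ) :
    Set (EuclideanSpace ℝ (Fin d)) :=
  ⋂ c ∈ C, closedBall c r

/-- The `r`-convex hull of `X`. -/
def rConvexHull {d : ℕ} (r : ℝ) (X : Set (EuclideanSpace ℝ (Fin d))) :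
    Set (EuclideanSpace ℝ (Fin d)) :=
  ⋂ x ∈ {x | X ⊆ closedBall x r}, closedBall x r

/-- `C` lies in `r`-convex position. -/
def RConvexPosition {d : ℕ} (r : ℝ) (C : Set (EuclideanSpace ℝ (Fin d))) : Prop :=
  (∃ p, C ⊆ ball p r) ∧ ∀ c ∈ C, c ∉ rConvexHull r (C \ {c})

/-- `P_{C,r}` is a basic `r`-ball polyhedron with center-polytope `conv C`. -/
def IsBasicBallPolyhedron {d : ℕ} (C : Set (EuclideanSpace ℝ (Fin d))) (r : ℝ) : Prop :=
  0 < r ∧ C.Finite ∧ d + 1 ≤ C.ncard ∧ 2 ≤ d ∧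
  setDim (convexHull ℝ C) = d ∧
  C = Set.extremePoints ℝ (convexHull ℝ C) ∧
  RConvexPosition r C ∧
  ∀ S ⊆ C, ∀ v, vorF C S = {v} → v ∈ interior (ballPoly C r)

/-- `fFace C r k` is the number of `(k-1)`-dimensional faces of `P_{C,r}`, i.e. the number of
`S ⊆ C` with `V_S ∩ bd(P_{C,r}) ≠ ∅` and `dim V_S = k`. -/
noncomputable def fFace {d : ℕ} (C : Set (EuclideanSpace ℝ (Fin d))) (r : ℝ) (k : ℕ) : ℕ :=
  {S : Set (EuclideanSpace ℝ (Fin d)) | S ⊆ C ∧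
    (vorF C S ∩ frontier (ballPoly C r)).Nonempty ∧ setDim (vorF C S) = k}.ncard

/-- If a linear functional is bounded on `C` by its value on `S`, then `V_S` is closed under
translation in the opposite direction. -/
lemma sub_smul_mem_vorF {d : ℕ} {C S : Set (EuclideanSpace ℝ (Fin d))}
    {x u : EuclideanSpace ℝ (Fin d)} {m t : ℝ} (hne : S.Nonempty) (hx : x ∈ vorF C S)
    (hC : ∀ c ∈ C, ⟪u, c⟫ ≤ m) (hS : ∀ s ∈ S, ⟪u, s⟫ = m) (ht : 0 ≤ t) :
    x - t • u ∈ vorF C S := by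
  have hmem (c) : c ∈ S ↔ c ∈ C ∧ ∀ c' ∈ C, dist x c' ≤ dist x c := by
    have hx' : S = {c | c ∈ C ∧ ∀ c' ∈ C, dist x c' ≤ dist x c} := hx
    exact iff_of_eq (congrArg (c ∈ ·) hx')
  have key (a b) : dist (x - t • u) a ≤ dist (x - t • u) b ↔
      dist x a ^ 2 + 2 * t * ⟪u, a⟫ ≤ dist x b ^ 2 + 2 * t * ⟪u, b⟫ := by
    have expand (c) : dist (x - t • u) c ^ 2 =
        dist x c ^ 2 + 2 * t * ⟪u, c⟫ + (t ^ 2 * ‖u‖ ^ 2 - 2 * t * ⟪u, x⟫) := by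
      rw [dist_eq_norm, dist_eq_norm, sub_right_comm, norm_sub_sq_real, inner_smul_right,
        norm_smul, mul_pow, Real.norm_eq_abs, sq_abs, real_inner_comm, inner_sub_right]
      ring
    rw [← sq_le_sq₀ dist_nonneg dist_nonneg, expand, expand, add_le_add_iff_right]
  change S = {c | c ∈ C ∧ ∀ c' ∈ C, dist (x - t • u) c' ≤ dist (x - t • u) c}
  ext c
  simp only [mem_ofPred_eq, key]
  constructor
  · intro hc
    refine ⟨((hmem c).1 hc).1, fun c' hc' => ?_⟩
    rw [hS c hc]
    have := ((hmem c).1 hc).2 c' hc'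
    have := hC c' hc'
    gcongr
  · rintro ⟨hc, hmax⟩
    obtain ⟨s, hs⟩ := hne
    obtain ⟨hsC, hsmax⟩ := (hmem s).1 hs
    refine (hmem c).2 ⟨hc, fun c' hc' => (hsmax c' hc').trans ?_⟩
    have h₁ := hmax s hsC
    rw [hS s hs] at h₁
    have h₂ := mul_le_mul_of_nonneg_left (hC c hc) (by positivity : 0 ≤ 2 * t)
    rw [← sq_le_sq₀ dist_nonneg dist_nonneg]
    linarith

/-- A finite set whose convex hull lies on the frontier of a convex set with nonempty interior
lies in a proper supporting hyperplane of that set. -/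
lemma exists_supporting_functional {E : Type*} [AddCommGroup E] [Module ℝ E] [TopologicalSpace E]
    [IsTopologicalAddGroup E] [ContinuousSMul ℝ E] {K S : Set E} (hK : Convex ℝ K)
    (hint : (interior K).Nonempty) (hfin : S.Finite) (hne : S.Nonempty)
    (hbd : convexHull ℝ S ⊆ frontier K) (hSK : S ⊆ K) :
    ∃ (f : StrongDual ℝ E) (m : ℝ), f ≠ 0 ∧ (∀ y ∈ K, f y ≤ m) ∧ ∀ s ∈ S, f s = m := by
  lift S to Finset E using hfin
  have hpos : (0 : ℝ) < S.card := by
    exact_mod_cast Finset.card_pos.2 (Finset.coe_nonempty.1 hne)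
  set p : E := S.centerMass (fun _ => (1 : ℝ)) id with hp
  have hpS : p ∈ convexHull ℝ (S : Set E) :=
    S.centerMass_mem_convexHull (fun _ _ => zero_le_one) (by simpa using hpos) fun _ h => h
  obtain ⟨f, hf⟩ := geometric_hahn_banach_open_point hK.interior isOpen_interior (hbd hpS).2
  have hle : ∀ y ∈ K, f y ≤ f p := by
    intro y hy
    have hy' : y ∈ closure (interior K) := by
      rw [hK.closure_interior_eq_closure_of_nonempty_interior hint]
      exact subset_closure hy
    exact closure_minimal (fun a ha => (hf a ha).le)
      (isClosed_le f.continuous continuous_const) hy'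
  refine ⟨f, f p, ?_, hle, ?_⟩
  · rintro rfl
    obtain ⟨a, ha⟩ := hint
    simpa using hf a ha
  · have hsum : ∑ s ∈ S, f s = ∑ _s ∈ S, f p := by
      simp [hp, Finset.centerMass, hpos.ne']
    exact (Finset.sum_eq_sum_iff_of_le fun s hs => hle s (hSK hs)).1 hsum

lemma interior_convexHull_nonempty_of_setDim_eq {d : ℕ} {C : Set (EuclideanSpace ℝ (Fin d))}
    (hne : C.Nonempty) (hdim : setDim (convexHull ℝ C) = d) :
    (interior (convexHull ℝ C)).Nonempty := by
  rw [interior_convexHull_nonempty_iff_affineSpan_eq_top,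
    ← AffineSubspace.direction_eq_top_iff_of_nonempty ((affineSpan_nonempty ℝ).2 hne)]
  apply Submodule.eq_top_of_finrank_eq
  rw [finrank_euclideanSpace_fin]
  rwa [setDim, affineSpan_convexHull] at hdim

lemma nonempty_of_vorF_nonempty {d : ℕ} {C S : Set (EuclideanSpace ℝ (Fin d))}
    (hfin : C.Finite) (hC : C.Nonempty) (hne : (vorF C S).Nonempty) : S.Nonempty := by
  obtain ⟨x, hx⟩ := hne
  obtain ⟨c, hc, hmax⟩ := C.exists_max_image (dist x) hfin hC
  have hx' : S = {c | c ∈ C ∧ ∀ c' ∈ C, dist x c' ≤ dist x c} := hx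
  exact hx' ▸ ⟨c, hc, hmax⟩

/-- if `conv S` lies on the boundary of the center-polytope then the
farthest-point Voronoi face `V_S` is unbounded. -/
theorem stmt12 {d n : ℕ} (hd : 2 ≤ d) (hn : d + 1 ≤ n)
    (C : Set (EuclideanSpace ℝ (Fin d))) (hfin : C.Finite) (hcard : C.ncard = n)
    (hdim : setDim (convexHull ℝ C) = d)
    (hvert : C = Set.extremePoints ℝ (convexHull ℝ C))
    (S : Set (EuclideanSpace ℝ (Fin d))) (hS : S ⊆ C)
    (hne : (vorF C S).Nonempty)
    (hbd : convexHull ℝ S ⊆ frontier (convexHull ℝ C)) :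
    ¬ Bornology.IsBounded (vorF C S) := by
  have hCne : C.Nonempty := (ncard_pos hfin).1 (by omega)
  have hSne := nonempty_of_vorF_nonempty hfin hCne hne
  obtain ⟨f, m, hf, hle, heq⟩ := exists_supporting_functional (convex_convexHull ℝ C)
    (interior_convexHull_nonempty_of_setDim_eq hCne hdim) (hfin.subset hS) hSne hbd
    (hS.trans (subset_convexHull ℝ C))
  obtain ⟨u, rfl⟩ := (InnerProductSpace.toDual ℝ (EuclideanSpace ℝ (Fin d))).surjective f
  simp only [InnerProductSpace.toDual_apply_apply] at hle heq
  have hu : 0 < ‖u‖ := norm_pos_iff.2 fun h => hf (by simp [h])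
  obtain ⟨x, hx⟩ := hne
  have hray {t : ℝ} (ht : 0 ≤ t) : x - t • u ∈ vorF C S :=
    sub_smul_mem_vorF hSne hx (fun c hc => hle c (subset_convexHull ℝ C hc)) heq ht
  intro hb
  obtain ⟨R, hR⟩ := hb.subset_closedBall x
  have hR₀ : 0 ≤ R := by simpa using hR hx
  have h := hR (hray (t := (R + 1) / ‖u‖) (by positivity))
  rw [mem_closedBall, dist_eq_norm, sub_sub_cancel_left, norm_neg, norm_smul, Real.norm_eq_abs,
    abs_of_nonneg (by positivity), div_mul_cancel₀ _ hu.ne'] at h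
  linarith
end

section
/- Let d ≥ 2, r > 0, and let C = {c₁, …, c_n} ⊆ E^d be a set of n ≥ 2 distinct points. Then the following are equivalent: (a) int(⋂_{i=1}^n B[c_i, r]) ≠ ∅ and the family of balls is reduced, i.e., for every 1 ≤ i ≤ n, ⋂_{j ≠ i} B[c_j, r] ≠ ⋂_{j=1}^n B[c_j, r]; (b) C lies in r-convex position. -/
open Metric Set
open scoped RealInnerProductSpace

lemma mem_ballPoly {d : ℕ} {C : Set (EuclideanSpace ℝ (Fin d))} {r : ℝ}
    {y : EuclideanSpace ℝ (Fin d)} : y ∈ ballPoly C r ↔ C ⊆ closedBall y r := by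
  simp only [ballPoly, mem_iInter, subset_def]
  exact forall₂_congr fun c _ => mem_closedBall_comm

lemma interior_ballPoly {d : ℕ} {C : Set (EuclideanSpace ℝ (Fin d))} (hfin : C.Finite)
    {r : ℝ} (hr : r ≠ 0) : interior (ballPoly C r) = ⋂ c ∈ C, ball c r := by
  rw [ballPoly, hfin.interior_biInter]
  simp only [interior_closedBall _ hr]

lemma interior_ballPoly_nonempty_iff {d : ℕ} {C : Set (EuclideanSpace ℝ (Fin d))}
    (hfin : C.Finite) {r : ℝ} (hr : r ≠ 0) :
    (interior (ballPoly C r)).Nonempty ↔ ∃ p, C ⊆ ball p r := by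
  rw [interior_ballPoly hfin hr]
  simp only [Set.Nonempty, mem_iInter, subset_def]
  exact exists_congr fun p => forall₂_congr fun c _ => mem_ball_comm

lemma notMem_rConvexHull_diff_iff {d : ℕ} {C : Set (EuclideanSpace ℝ (Fin d))} {r : ℝ}
    {c : EuclideanSpace ℝ (Fin d)} (hc : c ∈ C) :
    c ∉ rConvexHull r (C \ {c}) ↔ ballPoly (C \ {c}) r ≠ ballPoly C r := by
  rw [ne_eq, not_iff_not, Set.ext_iff]
  simp only [rConvexHull, mem_iInter, mem_ofPred_eq, mem_ballPoly]
  refine forall_congr' fun y => ⟨fun h => ⟨fun hy => ?_, sdiff_subset.trans⟩,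
    fun h hy => h.1 hy hc⟩
  rw [← insert_sdiff_self_of_mem hc]
  exact insert_subset (h hy) hy

/-- the intersection of the balls `B[c,r]`, `c ∈ C`, has nonempty interior and
the family of balls is reduced if and only if `C` lies in `r`-convex position. -/
theorem stmt13 {d : ℕ} (hd : 2 ≤ d) (r : ℝ) (hr : 0 < r)
    (C : Set (EuclideanSpace ℝ (Fin d))) (hfin : C.Finite) (hcard : 2 ≤ C.ncard) :
    ((interior (ballPoly C r)).Nonempty ∧
        ∀ c ∈ C, ballPoly (C \ {c}) r ≠ ballPoly C r) ↔
      RConvexPosition r C := by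
  rw [RConvexPosition, interior_ballPoly_nonempty_iff hfin hr.ne']
  exact and_congr_right fun _ => forall₂_congr fun c hc => (notMem_rConvexHull_diff_iff hc).symm
end

section
/- Let P_{C,r} be a basic r-ball polyhedron in E³ with center-polytope conv(C), where |C| = n ≥ 4 (so P_{C,r} has n facets). Then P_{C,r} has at most 2n − 4 vertices and at most 3n − 6 edges, i.e., f₀(P_{C,r}) ≤ 2n − 4 and f₁(P_{C,r}) ≤ 3n − 6. -/
open Metric Set
open scoped RealInnerProductSpace

/-- Euclidean 3-space. -/
abbrev E3 : Type := EuclideanSpace ℝ (Fin 3)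

/-- The set of points of `C` farthest from `z`. -/
def farSet (C : Set E3) (z : E3) : Set E3 :=
  {c | c ∈ C ∧ ∀ c' ∈ C, dist z c' ≤ dist z c}

/-- The squared distance from `z` to `c`, normalized by subtracting `‖z‖ ^ 2`. -/
noncomputable def normPow (z c : E3) : ℝ := ⟪c, c⟫ - 2 * ⟪z, c⟫

/-- The scalar triple product. -/
def triple (x y z : E3) : ℝ :=
  x 0 * (y 1 * z 2 - y 2 * z 1) - x 1 * (y 0 * z 2 - y 2 * z 0) + x 2 * (y 0 * z 1 - y 1 * z 0)

/-- The cross product. -/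
def cross (x y : E3) : E3 :=
  !₂[x 1 * y 2 - x 2 * y 1, x 2 * y 0 - x 0 * y 2, x 0 * y 1 - x 1 * y 0]

lemma inner_coord (x y : E3) : ⟪x, y⟫ = x 0 * y 0 + x 1 * y 1 + x 2 * y 2 := by
  simp [PiLp.inner_apply, Fin.sum_univ_three, mul_comm]

lemma inner_cross_left (x y : E3) : ⟪cross x y, x⟫ = 0 := by
  simp [inner_coord, cross]; ring

lemma inner_cross_right (x y : E3) : ⟪cross x y, y⟫ = 0 := by
  simp [inner_coord, cross]; ring

lemma inner_cross (x y z : E3) : ⟪cross x y, z⟫ = triple x y z := by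
  simp [inner_coord, cross, triple]; ring

lemma inner_self_smul_eq (x y : E3) :
    ⟪x, x⟫ • y = ⟪x, y⟫ • x + cross (cross x y) x := by
  rw [inner_coord, inner_coord]
  ext i
  fin_cases i <;> simp [cross] <;> ring

lemma inner_cross_cross (x y : E3) :
    ⟪cross x y, cross x y⟫ = ⟪x, x⟫ * ⟪y, y⟫ - ⟪x, y⟫ * ⟪y, x⟫ := by
  simp only [inner_coord]
  simp [cross]
  ring

lemma triple_swap_left (x y z : E3) : triple y x z = -triple x y z := by
  simp only [triple]; ring

lemma triple_swap_outer (x y z : E3) : triple z y x = -triple x y z := by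
  simp only [triple]; ring

/-- The product of two triple products is a Gram determinant. -/
lemma triple_mul_triple (x y z x' y' z' : E3) :
    triple x y z * triple x' y' z' =
      ⟪x, x'⟫ * (⟪y, y'⟫ * ⟪z, z'⟫ - ⟪y, z'⟫ * ⟪z, y'⟫)
      - ⟪x, y'⟫ * (⟪y, x'⟫ * ⟪z, z'⟫ - ⟪y, z'⟫ * ⟪z, x'⟫)
      + ⟪x, z'⟫ * (⟪y, x'⟫ * ⟪z, y'⟫ - ⟪y, y'⟫ * ⟪z, x'⟫) := by
  simp only [inner_coord, triple]; ring

lemma triple_smul_eq (x y z v : E3) :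
    triple x y z • v = triple v y z • x + triple x v z • y + triple x y v • z := by
  ext i
  fin_cases i <;> simp [triple] <;> ring

lemma inner_self_pos_of_ne_zero {x : E3} (h : x ≠ 0) : 0 < ⟪x, x⟫ :=
  real_inner_self_pos.2 h

/-- Two vectors orthogonal to the same two independent vectors are proportional. -/
lemma exists_smul_eq_of_triple_ne_zero {u v g h : E3} (ht : triple u h g ≠ 0)
    (hug : ⟪u, g⟫ = 0) (huh : ⟪u, h⟫ = 0) (hvg : ⟪v, g⟫ = 0) (hvh : ⟪v, h⟫ = 0) :
    ∃ k : ℝ, v = k • u := by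
  have h1 : triple u v g * triple u h g = 0 := by
    rw [triple_mul_triple, huh, hug, hvh, hvg]; ring
  have h2 : triple u h v * triple u h g = 0 := by
    rw [triple_mul_triple, huh, hug, hvh, hvg]; ring
  have h1' := (mul_eq_zero.1 h1).resolve_right ht
  have h2' := (mul_eq_zero.1 h2).resolve_right ht
  have h3 := triple_smul_eq u h g v
  rw [h1', h2'] at h3
  refine ⟨(triple u h g)⁻¹ * triple v h g, ?_⟩
  rw [mul_smul, eq_inv_smul_iff₀ ht, h3]
  simp

/-- In the plane orthogonal to `e`, two half-planes whose boundary rays have the same orientation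
and lie in each other are parallel. -/
lemma inner_eq_zero_of_same_orientation {e w₁ w₂ v₁ v₂ : E3}
    (hw₁ : ⟪w₁, e⟫ = 0) (hw₂ : ⟪w₂, e⟫ = 0) (hv₁ : ⟪v₁, w₁⟫ = 0) (hv₂ : ⟪v₂, w₂⟫ = 0)
    (hs : 0 < triple v₁ e w₁ * triple v₂ e w₂) (h₁₂ : 0 ≤ ⟪v₁, w₂⟫) (h₂₁ : 0 ≤ ⟪v₂, w₁⟫) :
    ⟪v₁, w₂⟫ = 0 := by
  have he₁ : ⟪e, w₁⟫ = 0 := by rw [real_inner_comm]; exact hw₁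
  have he₂ : ⟪e, w₂⟫ = 0 := by rw [real_inner_comm]; exact hw₂
  have g₁ : triple v₁ e w₁ * triple w₂ e w₁ = ⟪v₁, w₂⟫ * (⟪e, e⟫ * ⟪w₁, w₁⟫) := by
    rw [triple_mul_triple, hv₁, hw₁, he₁, he₂]; ring
  have g₂ : triple v₂ e w₂ * -triple w₂ e w₁ = ⟪v₂, w₁⟫ * (⟪e, e⟫ * ⟪w₂, w₂⟫) := by
    rw [← triple_swap_outer, triple_mul_triple, hv₂, hw₂, he₁, he₂]; ring
  have p₁ : 0 ≤ ⟪v₁, w₂⟫ * (⟪e, e⟫ * ⟪w₁, w₁⟫) :=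
    mul_nonneg h₁₂ (mul_nonneg real_inner_self_nonneg real_inner_self_nonneg)
  have p₂ : 0 ≤ ⟪v₂, w₁⟫ * (⟪e, e⟫ * ⟪w₂, w₂⟫) :=
    mul_nonneg h₂₁ (mul_nonneg real_inner_self_nonneg real_inner_self_nonneg)
  have hz : triple w₂ e w₁ = 0 := by
    rcases mul_pos_iff.1 hs with ⟨a, b⟩ | ⟨a, b⟩ <;> nlinarith
  have hne : triple v₁ e w₁ ≠ 0 := fun h => by simp [h] at hs
  have he : e ≠ 0 := fun h => hne (by simp [h, triple])
  have hw : w₁ ≠ 0 := fun h => hne (by simp [h, triple])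
  rw [hz, mul_zero] at g₁
  have := mul_pos (inner_self_pos_of_ne_zero he) (inner_self_pos_of_ne_zero hw)
  exact (mul_eq_zero.1 g₁.symm).resolve_right this.ne'

lemma dist_le_dist_iff_normPow (z c c' : E3) :
    dist z c' ≤ dist z c ↔ normPow z c' ≤ normPow z c := by
  have h (c : E3) : dist z c ^ 2 = ⟪z, z⟫ + normPow z c := by
    rw [dist_eq_norm, ← real_inner_self_eq_norm_sq, normPow, real_inner_sub_sub_self]; ring
  rw [← sq_le_sq₀ dist_nonneg dist_nonneg, h, h]
  exact add_le_add_iff_left _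

lemma mem_farSet {C : Set E3} {z c : E3} :
    c ∈ farSet C z ↔ c ∈ C ∧ ∀ c' ∈ C, normPow z c' ≤ normPow z c := by
  simp only [farSet, mem_ofPred_eq, dist_le_dist_iff_normPow]

lemma farSet_subset (C : Set E3) (z : E3) : farSet C z ⊆ C := fun _ h => h.1

lemma farSet_nonempty {C : Set E3} (hf : C.Finite) (hne : C.Nonempty) (z : E3) :
    (farSet C z).Nonempty := by
  obtain ⟨c, hc, h⟩ := hf.exists_maximalFor (normPow z) C hne
  refine ⟨c, mem_farSet.2 ⟨hc, fun c' hc' => ?_⟩⟩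
  by_contra hlt
  exact hlt (h hc' (not_le.1 hlt).le)

lemma normPow_add_smul (z u c : E3) (s : ℝ) :
    normPow (z + s • u) c = normPow z c - 2 * s * ⟪u, c⟫ := by
  simp only [normPow, inner_add_left, real_inner_smul_left]; ring

lemma normPow_eq_of_mem_farSet {C : Set E3} {z a b : E3} (ha : a ∈ farSet C z)
    (hb : b ∈ farSet C z) : normPow z a = normPow z b :=
  le_antisymm ((mem_farSet.1 hb).2 a ha.1) ((mem_farSet.1 ha).2 b hb.1)

lemma normPow_lt_of_notMem_farSet {C : Set E3} {z a c : E3} (ha : a ∈ farSet C z)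
    (hc : c ∈ C) (hcf : c ∉ farSet C z) : normPow z c < normPow z a := by
  by_contra! h
  exact hcf (mem_farSet.2 ⟨hc, fun c' hc' => ((mem_farSet.1 ha).2 c' hc').trans h⟩)

lemma farSet_eq_of {C S : Set E3} {z a : E3} (ha : a ∈ S) (hSC : S ⊆ C)
    (heq : ∀ t ∈ S, normPow z t = normPow z a)
    (hlt : ∀ c ∈ C, c ∉ S → normPow z c < normPow z a) : farSet C z = S := by
  have hle : ∀ c ∈ C, normPow z c ≤ normPow z a := fun c hc => by
    by_cases h : c ∈ S
    · exact (heq c h).le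
    · exact (hlt c hc h).le
  ext c
  rw [mem_farSet]
  constructor
  · rintro ⟨hc, h⟩
    by_contra hcS
    exact absurd (h a (hSC ha)) (not_le.2 (hlt c hc hcS))
  · intro hc
    exact ⟨hSC hc, fun c' hc' => (hle c' hc').trans (heq c hc).ge⟩

/-- The face does not change along a recession direction. -/
lemma farSet_add_smul {C : Set E3} {z a u : E3} {s : ℝ} (ha : a ∈ farSet C z) (hs : 0 ≤ s)
    (hu : ∀ c ∈ C, 0 ≤ ⟪u, c - a⟫) (hu₀ : ∀ t ∈ farSet C z, ⟪u, t - a⟫ = 0) :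
    farSet C (z + s • u) = farSet C z := by
  refine farSet_eq_of ha (farSet_subset C z) (fun t ht => ?_) (fun c hc hcf => ?_)
  · have := hu₀ t ht
    rw [inner_sub_right] at this
    rw [normPow_add_smul, normPow_add_smul, normPow_eq_of_mem_farSet ht ha]
    linear_combination (-2 * s) * this
  · have h := hu c hc
    rw [inner_sub_right] at h
    rw [normPow_add_smul, normPow_add_smul]
    have := normPow_lt_of_notMem_farSet ha hc hcf
    nlinarith [mul_nonneg hs h]

/-- Starting at `y` and walking in a direction `v` along which the face is invariant, one either
stays in the face forever or reaches a point with more farthest points. -/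
lemma recession_or_exists_exit {C : Set E3} (hf : C.Finite) {y a v : E3} (ha : a ∈ farSet C y)
    (hv : ∀ t ∈ farSet C y, ⟪v, t - a⟫ = 0) :
    (∀ c ∈ C, 0 ≤ ⟪v, c - a⟫) ∨ ∃ s : ℝ, 0 < s ∧ ∃ c ∈ farSet C (y + s • v),
      ⟪v, c - a⟫ < 0 ∧ farSet C y ⊆ farSet C (y + s • v) := by
  by_cases hne : {c | c ∈ C ∧ ⟪v, c - a⟫ < 0}.Nonempty
  swap
  · left
    intro c hc
    by_contra! h
    exact hne ⟨c, hc, h⟩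
  right
  have hf' : {c | c ∈ C ∧ ⟪v, c - a⟫ < 0}.Finite := hf.subset fun c hc => hc.1
  let φ : E3 → ℝ := fun c => (normPow y a - normPow y c) / (-2 * ⟪v, c - a⟫)
  obtain ⟨c₀, ⟨hc₀, hv₀⟩, hmin⟩ := hf'.exists_minimalFor φ _ hne
  have hc₀f : c₀ ∉ farSet C y := fun h => hv₀.ne (hv c₀ h)
  have hpos : 0 < φ c₀ :=
    div_pos (sub_pos.2 (normPow_lt_of_notMem_farSet ha hc₀ hc₀f)) (by linarith)
  set s := φ c₀ with hs
  have hφ (c : E3) (h : ⟪v, c - a⟫ < 0) :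
      φ c * (-2 * ⟪v, c - a⟫) = normPow y a - normPow y c :=
    div_mul_cancel₀ _ (by linarith)
  have key (c : E3) (hc : c ∈ C) : normPow (y + s • v) c ≤ normPow (y + s • v) a := by
    rw [normPow_add_smul, normPow_add_smul]
    have hle := (mem_farSet.1 ha).2 c hc
    by_cases h : ⟪v, c - a⟫ < 0
    · have h1 := hφ c h
      have h2 : s ≤ φ c := by
        by_contra hlt
        exact hlt (hmin ⟨hc, h⟩ (not_le.1 hlt).le)
      have h3 := mul_le_mul_of_nonneg_right h2 (show 0 ≤ -2 * ⟪v, c - a⟫ by linarith)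
      rw [h1, inner_sub_right] at h3
      linarith
    · have := mul_nonneg hpos.le (not_lt.1 h)
      rw [inner_sub_right] at this
      linarith
  refine ⟨s, hpos, c₀, mem_farSet.2 ⟨hc₀, fun c hc => (key c hc).trans (le_of_eq ?_)⟩, hv₀,
    fun t ht => mem_farSet.2 ⟨ht.1, fun c hc => (key c hc).trans (le_of_eq ?_)⟩⟩
  · have := hφ c₀ hv₀
    rw [← hs, inner_sub_right] at this
    rw [normPow_add_smul, normPow_add_smul]
    linarith
  · have := hv t ht
    rw [inner_sub_right] at this
    rw [normPow_add_smul, normPow_add_smul, normPow_eq_of_mem_farSet ht ha]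
    linear_combination (2 * s) * this

/-- The properties of the center set of a basic ball polyhedron used for counting its faces. -/
structure BasicCenters (C : Set E3) (r : ℝ) : Prop where
  finite : C.Finite
  pos : 0 < r
  eq_zero_of_inner : ∀ a ∈ C, ∀ u : E3, (∀ c ∈ C, ⟪u, c - a⟫ = 0) → u = 0
  not_collinear : ∀ a ∈ C, ∀ b ∈ C, ∀ c ∈ C, a ≠ b → a ≠ c → b ≠ c → ¬ Collinear ℝ {a, b, c}
  dist_vertex_lt : ∀ v, vorF C (farSet C v) = {v} → ∀ c ∈ C, dist v c < r
  exists_ball : ∃ p, C ⊆ ball p r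

lemma collinear_triple_of_smul_eq {a b c : E3} {k : ℝ} (h : c - a = k • (b - a)) :
    Collinear ℝ {a, b, c} := by
  refine (collinear_iff_of_mem (p₀ := a) (by simp)).2 ⟨b - a, ?_⟩
  simp only [mem_insert_iff, mem_singleton_iff, forall_eq_or_imp, forall_eq]
  refine ⟨⟨0, by simp⟩, ⟨1, by simp⟩, ⟨k, ?_⟩⟩
  rw [← h]; simp

lemma cross_ne_zero_of_not_collinear {a b c : E3} (hab : a ≠ b)
    (h : ¬ Collinear ℝ {a, b, c}) : cross (b - a) (c - a) ≠ 0 := by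
  intro h0
  have hg := (inner_self_pos_of_ne_zero (sub_ne_zero.2 hab.symm)).ne'
  have hc : cross 0 (b - a) = 0 := by
    ext i
    fin_cases i <;> simp [cross]
  have h1 := inner_self_smul_eq (b - a) (c - a)
  rw [h0, hc, add_zero] at h1
  refine h (collinear_triple_of_smul_eq (k := ⟪b - a, b - a⟫⁻¹ * ⟪b - a, c - a⟫) ?_)
  rw [mul_smul, ← h1, inv_smul_smul₀ hg]

lemma triple_ne_zero_of_orthogonal {u g h : E3} (hu : u ≠ 0) (hug : ⟪u, g⟫ = 0)
    (huh : ⟪u, h⟫ = 0) (hc : cross g h ≠ 0) : triple u g h ≠ 0 := by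
  intro h0
  have h1 := triple_mul_triple u g h u g h
  rw [hug, huh, h0, ← inner_cross_cross] at h1
  have := mul_pos (inner_self_pos_of_ne_zero hu) (inner_self_pos_of_ne_zero hc)
  linarith

/-- A face none of whose directions survive is a vertex. -/
lemma vorF_farSet_eq_singleton {C : Set E3} {z a : E3} (ha : a ∈ farSet C z)
    (h : ∀ d : E3, (∀ t ∈ farSet C z, ⟪d, t - a⟫ = 0) → d = 0) :
    vorF C (farSet C z) = {z} := by
  ext x
  rw [mem_singleton_iff]
  constructor
  · intro hx
    have hx : farSet C z = farSet C x := hx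
    refine sub_eq_zero.1 (h (x - z) fun t ht => ?_)
    have h1 := normPow_eq_of_mem_farSet ht ha
    have h2 := normPow_eq_of_mem_farSet (hx ▸ ht) (hx ▸ ha)
    simp only [normPow] at h1 h2
    rw [inner_sub_left, inner_sub_right, inner_sub_right]
    linarith
  · rintro rfl
    rfl

namespace BasicCenters

variable {C : Set E3} {r : ℝ}

lemma cross_ne_zero (hC : BasicCenters C r) {a b c : E3} (ha : a ∈ C) (hb : b ∈ C) (hc : c ∈ C)
    (hab : a ≠ b) (hac : a ≠ c) (hbc : b ≠ c) : cross (b - a) (c - a) ≠ 0 :=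
  cross_ne_zero_of_not_collinear hab (hC.not_collinear a ha b hb c hc hab hac hbc)

lemma dist_lt_of_rigid (hC : BasicCenters C r) {z a : E3} (ha : a ∈ farSet C z)
    (h : ∀ d : E3, (∀ t ∈ farSet C z, ⟪d, t - a⟫ = 0) → d = 0) : dist z a < r :=
  hC.dist_vertex_lt z (vorF_farSet_eq_singleton ha h) a ha.1

lemma exists_smul_eq (hC : BasicCenters C r) {a b c u d : E3} (ha : a ∈ C) (hb : b ∈ C)
    (hc : c ∈ C) (hab : a ≠ b) (hac : a ≠ c) (hbc : b ≠ c) (hu : u ≠ 0)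
    (hub : ⟪u, b - a⟫ = 0) (huc : ⟪u, c - a⟫ = 0) (hdb : ⟪d, b - a⟫ = 0)
    (hdc : ⟪d, c - a⟫ = 0) : ∃ k : ℝ, d = k • u :=
  exists_smul_eq_of_triple_ne_zero
    (triple_ne_zero_of_orthogonal hu hub huc (hC.cross_ne_zero ha hb hc hab hac hbc))
    huc hub hdc hdb

/-- Two nonzero recession directions that are orthogonal to the same facet are
positively proportional. -/
lemma exists_pos_smul_eq (hC : BasicCenters C r) {a b c u v : E3} (ha : a ∈ C) (hb : b ∈ C)
    (hc : c ∈ C) (hab : a ≠ b) (hac : a ≠ c) (hbc : b ≠ c) (hu : u ≠ 0) (hv : v ≠ 0)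
    (hub : ⟪u, b - a⟫ = 0) (huc : ⟪u, c - a⟫ = 0) (hvb : ⟪v, b - a⟫ = 0)
    (hvc : ⟪v, c - a⟫ = 0) (hur : ∀ x ∈ C, 0 ≤ ⟪u, x - a⟫) (hvr : ∀ x ∈ C, 0 ≤ ⟪v, x - a⟫) :
    ∃ k : ℝ, 0 < k ∧ v = k • u := by
  obtain ⟨k, rfl⟩ := hC.exists_smul_eq ha hb hc hab hac hbc hu hub huc hvb hvc
  refine ⟨k, ?_, rfl⟩
  by_contra! hk
  refine hv (hC.eq_zero_of_inner a ha _ fun x hx => le_antisymm ?_ (hvr x hx))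
  rw [real_inner_smul_left]
  exact mul_nonpos_of_nonpos_of_nonneg hk (hur x hx)

/-- The edge of the Voronoi diagram through a point outside the interior of the ball polyhedron
is a ray that starts in the interior. -/
lemma exists_recession (hC : BasicCenters C r) {z a b c : E3} (ha : a ∈ farSet C z)
    (hb : b ∈ farSet C z) (hc : c ∈ farSet C z) (hab : a ≠ b) (hac : a ≠ c) (hbc : b ≠ c)
    (hz : r ≤ dist z a) :
    ∃ (u : E3) (s : ℝ), u ≠ 0 ∧ (∀ x ∈ C, 0 ≤ ⟪u, x - a⟫) ∧ (∀ t ∈ farSet C z, ⟪u, t - a⟫ = 0) ∧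
      0 < s ∧ dist (z - s • u) a < r ∧ farSet C z ⊆ farSet C (z - s • u) := by
  have hu₀ := hC.cross_ne_zero ha.1 hb.1 hc.1 hab hac hbc
  set u₀ := cross (b - a) (c - a) with hu₀def
  have hub : ⟪u₀, b - a⟫ = 0 := inner_cross_left _ _
  have huc : ⟪u₀, c - a⟫ = 0 := inner_cross_right _ _
  have hpar (d : E3) (h : ∀ t ∈ farSet C z, ⟪d, t - a⟫ = 0) : ∃ k : ℝ, d = k • u₀ :=
    hC.exists_smul_eq ha.1 hb.1 hc.1 hab hac hbc hu₀ hub huc (h b hb) (h c hc)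
  have hinv : ∀ t ∈ farSet C z, ⟪u₀, t - a⟫ = 0 := by
    intro t ht
    by_contra hne
    refine absurd (hC.dist_lt_of_rigid ha fun d hd => ?_) (not_lt.2 hz)
    obtain ⟨k, rfl⟩ := hpar d hd
    have := hd t ht
    rw [real_inner_smul_left] at this
    rw [(mul_eq_zero.1 this).resolve_right hne, zero_smul]
  have exit (u : E3) (k₀ : ℝ) (hk₀ : u = k₀ • u₀) (hk : k₀ ≠ 0) :
      (∀ x ∈ C, 0 ≤ ⟪u, x - a⟫) ∨ ∃ s : ℝ, 0 < s ∧ dist (z + s • u) a < r ∧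
        farSet C z ⊆ farSet C (z + s • u) := by
    have hu : ∀ t ∈ farSet C z, ⟪u, t - a⟫ = 0 := fun t ht => by
      rw [hk₀, real_inner_smul_left, hinv t ht, mul_zero]
    rcases recession_or_exists_exit hC.finite ha hu with h | ⟨s, hs, x, hx, hxu, hsub⟩
    · exact Or.inl h
    refine Or.inr ⟨s, hs, hC.dist_lt_of_rigid (hsub ha) fun d hd => ?_, hsub⟩
    obtain ⟨k, rfl⟩ := hpar d fun t ht => hd t (hsub ht)
    have := hd x hx
    rw [hk₀, real_inner_smul_left] at hxu
    rw [real_inner_smul_left] at this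
    have hne : ⟪u₀, x - a⟫ ≠ 0 := fun h => by simp [h] at hxu
    rw [(mul_eq_zero.1 this).resolve_right hne, zero_smul]
  rcases exit u₀ 1 (one_smul _ _).symm one_ne_zero with h1 | ⟨s₁, hs₁, hd₁, hsub₁⟩ <;>
  rcases exit (-u₀) (-1) (by simp) (by simp) with h2 | ⟨s₂, hs₂, hd₂, hsub₂⟩
  · refine absurd (hC.eq_zero_of_inner a ha.1 u₀ fun x hx => ?_) hu₀
    have := h2 x hx
    rw [inner_neg_left] at this
    exact le_antisymm (by linarith) (h1 x hx)
  · rw [smul_neg, ← sub_eq_add_neg] at hd₂ hsub₂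
    exact ⟨u₀, s₂, hu₀, h1, hinv, hs₂, hd₂, hsub₂⟩
  · refine ⟨-u₀, s₁, neg_ne_zero.2 hu₀, h2, fun t ht => by rw [inner_neg_left, hinv t ht, neg_zero],
      hs₁, ?_, ?_⟩
    · simpa using hd₁
    · simpa using hsub₁
  · exfalso
    have hcv := convex_ball a r
    have hm := hcv (mem_ball.2 hd₁) (mem_ball.2 hd₂) (a := s₂ / (s₁ + s₂)) (b := s₁ / (s₁ + s₂))
      (by positivity) (by positivity) (by field_simp; ring)
    have he : (s₂ / (s₁ + s₂)) • (z + s₁ • u₀) + (s₁ / (s₁ + s₂)) • (z + s₂ • -u₀) = z := by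
      have : s₁ + s₂ ≠ 0 := by positivity
      have e1 : s₂ / (s₁ + s₂) + s₁ / (s₁ + s₂) = 1 := by field_simp; ring
      have e2 : s₂ / (s₁ + s₂) * s₁ - s₁ / (s₁ + s₂) * s₂ = 0 := by field_simp; ring
      calc _ = (s₂ / (s₁ + s₂) + s₁ / (s₁ + s₂)) • z
          + (s₂ / (s₁ + s₂) * s₁ - s₁ / (s₁ + s₂) * s₂) • u₀ := by module
        _ = z := by rw [e1, e2]; simp
    rw [he, mem_ball] at hm
    exact absurd hm (not_lt.2 hz)

end BasicCenters

lemma inner_sub_self_eq_of_normPow_eq {a b q : E3} (h : normPow q a = normPow q b) :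
    ⟪q - a, q - a⟫ = ⟪q - (1 / 2 : ℝ) • (a + b), q - (1 / 2 : ℝ) • (a + b)⟫ +
      ⟪b - a, b - a⟫ / 4 := by
  simp only [normPow] at h
  simp only [inner_sub_left, inner_sub_right, inner_add_left, inner_add_right,
    real_inner_smul_left, real_inner_smul_right]
  rw [real_inner_comm q a, real_inner_comm q b, real_inner_comm b a]
  linarith

lemma inner_sub_midpoint_eq_zero {a b q : E3} (h : normPow q a = normPow q b) :
    ⟪q - (1 / 2 : ℝ) • (a + b), b - a⟫ = 0 := by
  simp only [normPow] at h
  simp only [inner_sub_left, inner_sub_right, inner_add_left, real_inner_smul_left]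
  rw [real_inner_comm b a]
  linarith

/-- The point `z` is a vertex of the ball polyhedron on the face of the pair `a`, `b`, lying on the
side of that face determined by the orientation of `b - a`. The vector `u` is the direction of the
Voronoi edge through `z`, and `v` points from `z` into the face of `a` and `b`. -/
structure IsOrientedEnd (C : Set E3) (r : ℝ) (a b z u v : E3) : Prop where
  left_mem : a ∈ farSet C z
  right_mem : b ∈ farSet C z
  exists_third : ∃ c ∈ farSet C z, a ≠ c ∧ b ≠ c
  dist_eq : dist z a = r
  ne_zero : u ≠ 0
  recession : ∀ x ∈ C, 0 ≤ ⟪u, x - a⟫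
  orthogonal : ∀ t ∈ farSet C z, ⟪u, t - a⟫ = 0
  inner_edge : ⟪v, b - a⟫ = 0
  inner_pos : ∀ t ∈ farSet C z, t ≠ a → t ≠ b → 0 < ⟪v, t - a⟫
  triple_neg : triple u v (b - a) < 0

namespace BasicCenters

variable {C : Set E3} {r : ℝ}

/-- A Voronoi edge through a point outside the interior of the ball polyhedron meets its
boundary. -/
lemma exists_farSet_eq_dist_eq {z a u : E3} {s : ℝ} (ha : a ∈ farSet C z)
    (hz : r ≤ dist z a) (hu : ∀ t ∈ farSet C z, ⟪u, t - a⟫ = 0)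
    (hs : 0 < s) (hd : dist (z - s • u) a < r) (hsub : farSet C z ⊆ farSet C (z - s • u)) :
    ∃ x, farSet C x = farSet C z ∧ dist x a = r := by
  have hcont : ContinuousOn (fun t : ℝ => dist (z - t • u) a) (Icc 0 s) := by fun_prop
  obtain ⟨t, ht, hta⟩ := intermediate_value_Icc' hs.le hcont
    (show r ∈ Icc (dist (z - s • u) a) (dist (z - (0 : ℝ) • u) a) by
      exact ⟨hd.le, by simpa using hz⟩)
  have hta : dist (z - t • u) a = r := hta
  have hts : t < s := lt_of_le_of_ne ht.2 fun h => by
    rw [h] at hta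
    exact hd.ne hta
  refine ⟨z - t • u, ?_, hta⟩
  rw [sub_eq_add_neg, ← neg_smul]
  refine farSet_eq_of ha (farSet_subset C z) (fun c hc => ?_) (fun c hc hcf => ?_)
  · have := hu c hc
    rw [inner_sub_right] at this
    rw [normPow_add_smul, normPow_add_smul, normPow_eq_of_mem_farSet hc ha]
    linear_combination (2 * t) * this
  · have h1 := normPow_lt_of_notMem_farSet ha hc hcf
    have h2 := (mem_farSet.1 (hsub ha)).2 c hc
    rw [sub_eq_add_neg, ← neg_smul, normPow_add_smul, normPow_add_smul] at h2
    rw [normPow_add_smul, normPow_add_smul]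
    have h3 : 0 ≤ t * (normPow z a - normPow z c + 2 * s * (⟪u, a⟫ - ⟪u, c⟫)) :=
      mul_nonneg ht.1 (by linarith)
    have h4 := mul_pos (sub_pos.2 hts) (sub_pos.2 h1)
    have h5 : 0 < s * (normPow z a - normPow z c + 2 * t * (⟪u, a⟫ - ⟪u, c⟫)) := by
      nlinarith
    have h6 := (mul_pos_iff_of_pos_left hs).1 h5
    linarith

/-- Walking inside the face of the pair `a`, `b` along a line that avoids the interior of the ball
polyhedron, one either stays in the face forever or reaches an oriented end of the face. -/
lemma recession_or_exists_isOrientedEnd (hC : BasicCenters C r) {a b y v : E3} {R : ℝ}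
    (hab : a ≠ b) (hR : 0 ≤ R) (hRr : R ^ 2 + ⟪b - a, b - a⟫ / 4 = r ^ 2)
    (hy : farSet C y = {a, b}) (hv : v ≠ 0) (hvn : ⟪v, b - a⟫ = 0)
    (hfar : R * ‖cross v (b - a)‖ ≤ ⟪y - (1 / 2 : ℝ) • (a + b), cross v (b - a)⟫) :
    (∀ c ∈ C, 0 ≤ ⟪v, c - a⟫) ∨ ∃ z u w, IsOrientedEnd C r a b z u w := by
  have hay : a ∈ farSet C y := by simp [hy]
  have hby : b ∈ farSet C y := by simp [hy]
  have hinv : ∀ t ∈ farSet C y, ⟪v, t - a⟫ = 0 := by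
    rw [hy]
    rintro t (rfl | rfl)
    · simp
    · exact hvn
  rcases recession_or_exists_exit hC.finite hay hinv with h | ⟨s, hs, c, hc, hvc, hsub⟩
  · exact Or.inl h
  right
  set z := y + s • v with hz
  set m := (1 / 2 : ℝ) • (a + b) with hm
  set ν := cross v (b - a) with hν
  have hνpos : 0 < ‖ν‖ := by
    rw [norm_pos_iff, ← real_inner_self_pos, inner_cross_cross, hvn]
    have := mul_pos (inner_self_pos_of_ne_zero hv)
      (inner_self_pos_of_ne_zero (sub_ne_zero.2 hab.symm))
    simpa using this
  have haz := hsub hay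
  have hbz := hsub hby
  have hca : a ≠ c := by rintro rfl; simp at hvc
  have hcb : b ≠ c := by rintro rfl; exact hvc.ne hvn
  have hzν : R * ‖ν‖ ≤ ⟪z - m, ν⟫ := by
    have : ⟪v, ν⟫ = 0 := by rw [real_inner_comm]; exact inner_cross_left _ _
    rw [hz, add_sub_right_comm, inner_add_left, real_inner_smul_left, this]
    linarith
  have hzm : R ≤ ‖z - m‖ := le_of_mul_le_mul_right (hzν.trans (real_inner_le_norm _ _)) hνpos
  have hza : r ≤ dist z a := by
    refine le_of_sq_le_sq ?_ dist_nonneg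
    rw [dist_eq_norm, ← real_inner_self_eq_norm_sq,
      inner_sub_self_eq_of_normPow_eq (normPow_eq_of_mem_farSet haz hbz), ← hRr,
      real_inner_self_eq_norm_sq (z - m)]
    have := pow_le_pow_left₀ hR hzm 2
    linarith
  obtain ⟨u, s', hu, hur, huo, hs', hq, hqsub⟩ :=
    hC.exists_recession haz hbz hc hab hca hcb hza
  have huν : 0 < ⟪u, ν⟫ := by
    set q := z - s' • u with hqdef
    have h1 : ‖q - m‖ < R := by
      refine lt_of_pow_lt_pow_left₀ 2 hR ?_
      have h2 := inner_sub_self_eq_of_normPow_eq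
        (normPow_eq_of_mem_farSet (hqsub haz) (hqsub hbz))
      rw [real_inner_self_eq_norm_sq, real_inner_self_eq_norm_sq (q - _), ← dist_eq_norm,
        ← hm] at h2
      have h3 := pow_lt_pow_left₀ hq dist_nonneg two_ne_zero
      linarith
    have h4 : ⟪q - m, ν⟫ < R * ‖ν‖ :=
      (real_inner_le_norm _ _).trans_lt (mul_lt_mul_of_pos_right h1 hνpos)
    have h5 : ⟪q - m, ν⟫ = ⟪z - m, ν⟫ - s' * ⟪u, ν⟫ := by
      rw [hqdef, sub_right_comm, inner_sub_left, real_inner_smul_left]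
    have h6 : 0 < s' * ⟪u, ν⟫ := by linarith
    exact (mul_pos_iff_of_pos_left hs').1 h6
  obtain ⟨x, hx, hxa⟩ := exists_farSet_eq_dist_eq haz hza huo hs' hq hqsub
  refine ⟨x, u, -v, hx ▸ haz, hx ▸ hbz, ⟨c, hx ▸ hc, hca, hcb⟩, hxa, hu, hur,
    fun t ht => huo t (hx ▸ ht), by rw [inner_neg_left, hvn, neg_zero], fun t ht hta htb => ?_, ?_⟩
  · rw [hx] at ht
    have h1 := normPow_eq_of_mem_farSet ht haz
    have h2 : normPow y t < normPow y a :=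
      normPow_lt_of_notMem_farSet hay ht.1 (by simp [hy, hta, htb])
    rw [hz, normPow_add_smul, normPow_add_smul] at h1
    rw [inner_neg_left, inner_sub_right]
    have h6 : 0 < s * -(⟪v, t⟫ - ⟪v, a⟫) := by linarith
    exact (mul_pos_iff_of_pos_left hs).1 h6
  · rw [real_inner_comm, inner_cross] at huν
    have : triple u (-v) (b - a) = - triple v (b - a) u := by simp [triple]; ring
    rw [this]
    linarith

/-- Every edge of the ball polyhedron has an end with the prescribed orientation. -/
lemma exists_isOrientedEnd (hC : BasicCenters C r) {a b y : E3}
    (hab : a ≠ b) (hy : farSet C y = {a, b}) (hya : r ≤ dist y a) :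
    ∃ z u w, IsOrientedEnd C r a b z u w := by
  have hay : a ∈ farSet C y := by simp [hy]
  have hby : b ∈ farSet C y := by simp [hy]
  have hr := hC.pos
  obtain ⟨x, hx⟩ := hC.exists_ball
  have hn2 : ⟪b - a, b - a⟫ < 4 * r ^ 2 := by
    have h1 := hx hay.1
    have h2 := hx hby.1
    rw [mem_ball] at h1 h2
    have h3 : ‖b - a‖ < 2 * r := by
      rw [← dist_eq_norm]
      linarith [dist_triangle_right b a x]
    rw [real_inner_self_eq_norm_sq]
    nlinarith [norm_nonneg (b - a)]
  set n := b - a with hn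
  have hn0 : n ≠ 0 := sub_ne_zero.2 hab.symm
  have hnn := inner_self_pos_of_ne_zero hn0
  set R := √(r ^ 2 - ⟪n, n⟫ / 4) with hRdef
  have hRsq : R ^ 2 = r ^ 2 - ⟪n, n⟫ / 4 := Real.sq_sqrt (by linarith)
  have hR : 0 < R := Real.sqrt_pos.2 (by linarith)
  have hRr : R ^ 2 + ⟪n, n⟫ / 4 = r ^ 2 := by linarith
  set m := (1 / 2 : ℝ) • (a + b) with hm
  have hyab := normPow_eq_of_mem_farSet hay hby
  set p := y - m with hp
  have hpn : ⟪p, n⟫ = 0 := inner_sub_midpoint_eq_zero hyab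
  have hnp : ⟪n, p⟫ = 0 := by rw [real_inner_comm]; exact hpn
  have hpR : R ≤ ‖p‖ := by
    refine le_of_sq_le_sq ?_ (norm_nonneg _)
    have h1 := inner_sub_self_eq_of_normPow_eq hyab
    rw [real_inner_self_eq_norm_sq, ← dist_eq_norm, real_inner_self_eq_norm_sq (y - _), ← hm,
      ← hp, ← hn] at h1
    have := pow_le_pow_left₀ hr.le hya 2
    linarith
  have hppos : 0 < ‖p‖ := hR.trans_le hpR
  set σ := cross n p with hσ
  have hσn : ⟪σ, n⟫ = 0 := inner_cross_left _ _
  have hσp : ⟪σ, p⟫ = 0 := inner_cross_right _ _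
  have hpσ : ⟪p, σ⟫ = 0 := by rw [real_inner_comm]; exact hσp
  have hσσ : 0 < ⟪σ, σ⟫ := by
    rw [hσ, inner_cross_cross, hnp, zero_mul, sub_zero]
    exact mul_pos hnn (inner_self_pos_of_ne_zero (norm_pos_iff.1 hppos))
  have hσ0 : σ ≠ 0 := real_inner_self_pos.1 hσσ
  have hσnorm : 0 < ‖σ‖ := norm_pos_iff.2 hσ0
  have hσcross : cross σ n = ⟪n, n⟫ • p := by
    have := inner_self_smul_eq n p
    rw [hnp, zero_smul, zero_add] at this
    exact this.symm
  have hσcross' : cross (-σ) n = -(⟪n, n⟫ • p) := by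
    rw [← hσcross]
    ext i
    fin_cases i <;> simp [cross] <;> ring
  have hpcross : cross (-p) n = σ := by
    rw [hσ]
    ext i
    fin_cases i <;> simp [cross] <;> ring
  have hnorm : ‖⟪n, n⟫ • p‖ = ⟪n, n⟫ * ‖p‖ := by
    rw [norm_smul, Real.norm_of_nonneg hnn.le]
  by_contra hno
  have step {y' v : E3} (hy' : farSet C y' = {a, b}) (hv : v ≠ 0) (hvn : ⟪v, n⟫ = 0)
      (hfar : R * ‖cross v n‖ ≤ ⟪y' - m, cross v n⟫) : ∀ c ∈ C, 0 ≤ ⟪v, c - a⟫ :=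
    (hC.recession_or_exists_isOrientedEnd hab hR.le hRr hy' hv hvn hfar).resolve_right hno
  have move {y' v : E3} {s : ℝ} (hy' : farSet C y' = {a, b}) (hs : 0 ≤ s)
      (hvn : ⟪v, n⟫ = 0) (hv : ∀ c ∈ C, 0 ≤ ⟪v, c - a⟫) : farSet C (y' + s • v) = {a, b} := by
    rw [farSet_add_smul (by simp [hy']) hs hv, hy']
    rw [hy']
    rintro t (rfl | rfl)
    · simp
    · exact hvn
  have h₁ : ∀ c ∈ C, 0 ≤ ⟪σ, c - a⟫ := by
    refine step hy hσ0 hσn ?_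
    rw [hσcross, hnorm, ← hp, real_inner_smul_right, real_inner_self_eq_norm_sq p]
    nlinarith [mul_le_mul_of_nonneg_right hpR (mul_pos hnn hppos).le]
  have hy₁ := move hy (s := R / ‖σ‖) (by positivity) hσn h₁
  have h₂ : ∀ c ∈ C, 0 ≤ ⟪-p, c - a⟫ := by
    refine step hy₁ (neg_ne_zero.2 (norm_pos_iff.1 hppos)) (by simp [hpn]) ?_
    rw [hpcross, add_sub_right_comm, ← hp, inner_add_left, hpσ, real_inner_smul_left,
      real_inner_self_eq_norm_sq, zero_add]
    apply le_of_eq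
    field_simp
  have hy₂ := move hy₁ (s := 2) (by positivity) (by simp [hpn]) h₂
  have h₃ : ∀ c ∈ C, 0 ≤ ⟪-σ, c - a⟫ := by
    refine step hy₂ (neg_ne_zero.2 hσ0) (by simp [hσn]) ?_
    have e : y + (R / ‖σ‖) • σ + (2 : ℝ) • -p - m = (R / ‖σ‖) • σ - p := by
      rw [hp]; module
    rw [hσcross', norm_neg, hnorm, e, inner_neg_right, real_inner_smul_right,
      inner_sub_left ((R / ‖σ‖) • σ) p,
      real_inner_smul_left, hσp, real_inner_self_eq_norm_sq p]
    nlinarith [mul_le_mul_of_nonneg_right hpR (mul_pos hnn hppos).le]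
  refine hσ0 (hC.eq_zero_of_inner a hay.1 σ fun c hc => le_antisymm ?_ (h₁ c hc))
  have := h₃ c hc
  rw [inner_neg_left] at this
  linarith

end BasicCenters

/-- The point `z` is a vertex of the ball polyhedron on the facet with center `c`; its Voronoi edge
has direction `u`, and `c` lies between `a` and `b` with respect to the height function `e`. -/
structure IsFacetCorner (C : Set E3) (e c a b z u : E3) : Prop where
  mem : c ∈ farSet C z
  lower_mem : a ∈ farSet C z
  upper_mem : b ∈ farSet C z
  lower : ⟪e, a - c⟫ < 0
  upper : 0 < ⟪e, b - c⟫
  ne_zero : u ≠ 0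
  recession : ∀ x ∈ C, 0 ≤ ⟪u, x - c⟫
  orthogonal : ∀ t ∈ farSet C z, ⟪u, t - c⟫ = 0

namespace IsFacetCorner

variable {C : Set E3} {e c a b z u : E3}

lemma lower_ne (h : IsFacetCorner C e c a b z u) : c ≠ a := by
  rintro rfl
  simpa using h.lower

lemma upper_ne (h : IsFacetCorner C e c a b z u) : c ≠ b := by
  rintro rfl
  simpa using h.upper

lemma lower_ne_upper (h : IsFacetCorner C e c a b z u) : a ≠ b := by
  rintro rfl
  exact lt_asymm h.lower h.upper

lemma inner_lower (h : IsFacetCorner C e c a b z u) : ⟪u, a - c⟫ = 0 := h.orthogonal a h.lower_mem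

lemma inner_upper (h : IsFacetCorner C e c a b z u) : ⟪u, b - c⟫ = 0 := h.orthogonal b h.upper_mem

/-- The vector spanning the intersection of the facet plane of the corner with the horizontal
plane. -/
noncomputable def horizontal (_ : IsFacetCorner C e c a b z u) : E3 :=
  ⟪e, b - c⟫ • (a - c) - ⟪e, a - c⟫ • (b - c)

lemma inner_horizontal (h : IsFacetCorner C e c a b z u) (x : E3) :
    ⟪x, h.horizontal⟫ = ⟪e, b - c⟫ * ⟪x, a - c⟫ - ⟪e, a - c⟫ * ⟪x, b - c⟫ := by
  rw [horizontal, inner_sub_right, real_inner_smul_right, real_inner_smul_right]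

lemma inner_horizontal_height (h : IsFacetCorner C e c a b z u) : ⟪h.horizontal, e⟫ = 0 := by
  rw [real_inner_comm, h.inner_horizontal]; ring

lemma inner_horizontal_self_direction (h : IsFacetCorner C e c a b z u) :
    ⟪u, h.horizontal⟫ = 0 := by
  rw [h.inner_horizontal, h.inner_lower, h.inner_upper]; ring

lemma triple_mul_triple_neg (h : IsFacetCorner C e c a b z u) (hs : triple u (a - c) (b - c) ≠ 0) :
    triple u e h.horizontal * triple u (a - c) (b - c) < 0 := by
  have hw : h.horizontal ≠ 0 := by
    intro h0
    have : ⟪e, b - c⟫ * triple u (a - c) (b - c) = triple u h.horizontal (b - c) := by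
      rw [horizontal]; simp [triple]; ring
    rw [h0] at this
    have h1 : ⟪e, b - c⟫ * triple u (a - c) (b - c) = 0 := by rw [this]; simp [triple]
    exact mul_ne_zero h.upper.ne' hs h1
  have h1 := h.inner_horizontal h.horizontal
  have h2 : triple u e h.horizontal * triple u (a - c) (b - c) =
      -(⟪u, u⟫ * ⟪h.horizontal, h.horizontal⟫) := by
    rw [triple_mul_triple, h.inner_lower, h.inner_upper, h1]; ring
  rw [h2, neg_lt_zero]
  exact mul_pos (inner_self_pos_of_ne_zero h.ne_zero) (inner_self_pos_of_ne_zero hw)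

lemma triple_ne_zero {r : ℝ} (hC : BasicCenters C r) (h : IsFacetCorner C e c a b z u) :
    triple u (a - c) (b - c) ≠ 0 :=
  triple_ne_zero_of_orthogonal h.ne_zero h.inner_lower h.inner_upper
    (hC.cross_ne_zero h.mem.1 h.lower_mem.1 h.upper_mem.1 h.lower_ne h.upper_ne h.lower_ne_upper)

end IsFacetCorner

lemma inner_sub_le_of_mem_farSet {C : Set E3} {c t z z' : E3} (ht : t ∈ farSet C z)
    (hc : c ∈ farSet C z) (hc' : c ∈ farSet C z') : 0 ≤ ⟪z' - z, t - c⟫ := by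
  have h1 := normPow_eq_of_mem_farSet ht hc
  have h2 := (mem_farSet.1 hc').2 t ht.1
  simp only [normPow] at h1 h2
  rw [inner_sub_left, inner_sub_right, inner_sub_right]
  linarith

/-- A facet has at most one corner on each side of the horizontal plane section. -/
lemma BasicCenters.farSet_eq_of_isFacetCorner {C : Set E3} {r : ℝ} (hC : BasicCenters C r)
    {e c a₁ b₁ z₁ u₁ a₂ b₂ z₂ u₂ : E3} (h₁ : IsFacetCorner C e c a₁ b₁ z₁ u₁)
    (h₂ : IsFacetCorner C e c a₂ b₂ z₂ u₂)
    (hs : 0 < triple u₁ (a₁ - c) (b₁ - c) * triple u₂ (a₂ - c) (b₂ - c)) :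
    farSet C z₁ = farSet C z₂ := by
  have n₁ := h₁.triple_mul_triple_neg (h₁.triple_ne_zero hC)
  have n₂ := h₂.triple_mul_triple_neg (h₂.triple_ne_zero hC)
  have hs' : 0 < triple u₁ e h₁.horizontal * triple u₂ e h₂.horizontal := by
    have h := mul_pos_of_neg_of_neg n₁ n₂
    refine (mul_pos_iff_of_pos_right hs).1 ?_
    linarith
  have nonneg {a b z u a' b' z' u' : E3} (h : IsFacetCorner C e c a b z u)
      (h' : IsFacetCorner C e c a' b' z' u') : 0 ≤ ⟪u, h'.horizontal⟫ := by
    rw [h'.inner_horizontal]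
    nlinarith [mul_nonneg h'.upper.le (h.recession a' h'.lower_mem.1),
      mul_nonneg (neg_nonneg.2 h'.lower.le) (h.recession b' h'.upper_mem.1)]
  have h₂₁ : ⟪u₂, h₁.horizontal⟫ = 0 :=
    inner_eq_zero_of_same_orientation h₂.inner_horizontal_height h₁.inner_horizontal_height
      h₂.inner_horizontal_self_direction h₁.inner_horizontal_self_direction
      (by rwa [mul_comm]) (nonneg h₂ h₁) (nonneg h₁ h₂)
  have split {a b z u : E3} (h : IsFacetCorner C e c a b z u) {x : E3} (ha : 0 ≤ ⟪x, a - c⟫)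
      (hb : 0 ≤ ⟪x, b - c⟫) (h0 : ⟪x, h.horizontal⟫ = 0) :
      ⟪x, a - c⟫ = 0 ∧ ⟪x, b - c⟫ = 0 := by
    rw [h.inner_horizontal] at h0
    have p1 := mul_nonneg h.upper.le ha
    have p2 := mul_nonneg (neg_nonneg.2 h.lower.le) hb
    refine ⟨(mul_eq_zero.1 (show ⟪e, b - c⟫ * ⟪x, a - c⟫ = 0 by linarith)).resolve_left
      h.upper.ne', (mul_eq_zero.1 (show ⟪e, a - c⟫ * ⟪x, b - c⟫ = 0 by linarith)).resolve_left
      h.lower.ne⟩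
  obtain ⟨ha, hb⟩ := split h₁ (h₂.recession a₁ h₁.lower_mem.1)
    (h₂.recession b₁ h₁.upper_mem.1) h₂₁
  obtain ⟨k, hk, hu⟩ := hC.exists_pos_smul_eq h₁.mem.1 h₁.lower_mem.1 h₁.upper_mem.1
    h₁.lower_ne h₁.upper_ne h₁.lower_ne_upper h₁.ne_zero h₂.ne_zero h₁.inner_lower h₁.inner_upper
    ha hb h₁.recession h₂.recession
  have ht (w : E3) : triple u₂ e w = k * triple u₁ e w := by
    rw [hu]; simp [triple]; ring
  have hi (w : E3) : ⟪u₂, w⟫ = k * ⟪u₁, w⟫ := by rw [hu, real_inner_smul_left]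
  have hs'' : 0 < triple u₁ e h₁.horizontal * triple u₁ e h₂.horizontal := by
    rw [ht h₂.horizontal] at hs'
    refine (mul_pos_iff_of_pos_left hk).1 ?_
    linarith
  have hu₁₂ : ⟪u₁, h₂.horizontal⟫ = 0 := by
    have := h₂.inner_horizontal_self_direction
    rw [hi] at this
    exact (mul_eq_zero.1 this).resolve_left hk.ne'
  set d := z₂ - z₁ with hd
  have da₁ : 0 ≤ ⟪d, a₁ - c⟫ := inner_sub_le_of_mem_farSet h₁.lower_mem h₁.mem h₂.mem
  have db₁ : 0 ≤ ⟪d, b₁ - c⟫ := inner_sub_le_of_mem_farSet h₁.upper_mem h₁.mem h₂.mem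
  have dw₁ : 0 ≤ ⟪d, h₁.horizontal⟫ := by
    rw [h₁.inner_horizontal]
    nlinarith [mul_nonneg h₁.upper.le da₁, mul_nonneg (neg_nonneg.2 h₁.lower.le) db₁]
  have dw₂ : ⟪d, h₂.horizontal⟫ ≤ 0 := by
    have da₂ : 0 ≤ ⟪z₁ - z₂, a₂ - c⟫ := inner_sub_le_of_mem_farSet h₂.lower_mem h₂.mem h₁.mem
    have db₂ : 0 ≤ ⟪z₁ - z₂, b₂ - c⟫ := inner_sub_le_of_mem_farSet h₂.upper_mem h₂.mem h₁.mem
    rw [← neg_sub, inner_neg_left] at da₂ db₂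
    rw [h₂.inner_horizontal]
    nlinarith [mul_nonneg h₂.upper.le da₂, mul_nonneg (neg_nonneg.2 h₂.lower.le) db₂]
  have gram (w w' : E3) (hw : ⟪u₁, w⟫ = 0) (hwe : ⟪w, e⟫ = 0) :
      triple u₁ e w * triple u₁ e w' = (⟪u₁, u₁⟫ * ⟪e, e⟫ - ⟪e, u₁⟫ ^ 2) * ⟪w, w'⟫ := by
    rw [triple_mul_triple, hwe, real_inner_comm u₁ w, hw, real_inner_comm u₁ e]; ring
  have g₁ := gram _ h₁.horizontal h₁.inner_horizontal_self_direction h₁.inner_horizontal_height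
  have g₁' := gram _ d h₁.inner_horizontal_self_direction h₁.inner_horizontal_height
  have g₂' := gram _ d hu₁₂ h₂.inner_horizontal_height
  have hne : triple u₁ e h₁.horizontal ≠ 0 := fun h => by simp [h] at hs''
  have hG : 0 < ⟪u₁, u₁⟫ * ⟪e, e⟫ - ⟪e, u₁⟫ ^ 2 := by
    have h1 := mul_self_pos.2 hne
    rw [g₁] at h1
    exact pos_of_mul_pos_left h1 real_inner_self_nonneg
  rw [real_inner_comm d] at g₁' g₂'
  have hδ : triple u₁ e d = 0 := by
    have p1 := mul_nonneg hG.le dw₁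
    have p2 := mul_nonpos_of_nonneg_of_nonpos hG.le dw₂
    rcases mul_pos_iff.1 hs'' with ⟨p, q⟩ | ⟨p, q⟩ <;> nlinarith
  have dw : ⟪d, h₁.horizontal⟫ = 0 := by
    rw [hδ, mul_zero] at g₁'
    exact (mul_eq_zero.1 g₁'.symm).resolve_left hG.ne'
  obtain ⟨da, db⟩ := split h₁ da₁ db₁ dw
  obtain ⟨κ, hκ⟩ := hC.exists_smul_eq h₁.mem.1 h₁.lower_mem.1 h₁.upper_mem.1
    h₁.lower_ne h₁.upper_ne h₁.lower_ne_upper h₁.ne_zero h₁.inner_lower h₁.inner_upper da db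
  rcases le_total 0 κ with h0 | h0
  · have hz : z₂ = z₁ + κ • u₁ := by rw [← hκ, hd]; abel
    rw [hz, farSet_add_smul h₁.mem h0 h₁.recession h₁.orthogonal]
  · have hz : z₁ = z₂ + (-κ) • u₁ := by rw [neg_smul, ← hκ, hd]; abel
    rw [hz]
    refine farSet_add_smul h₂.mem (by linarith) h₁.recession fun t ht => ?_
    have := h₂.orthogonal t ht
    rw [hi] at this
    exact (mul_eq_zero.1 this).resolve_left hk.ne'

/-- A vertex of the ball polyhedron is the oriented end of at most one edge with a given starting
center. -/
lemma BasicCenters.eq_of_isOrientedEnd {C : Set E3} {r : ℝ} (hC : BasicCenters C r)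
    {a b b' z z' u u' v v' : E3} (hab : a ≠ b) (hab' : a ≠ b') (h : IsOrientedEnd C r a b z u v)
    (h' : IsOrientedEnd C r a b' z' u' v') (hz : farSet C z = farSet C z') : b = b' := by
  by_contra hbb
  have hb'z : b' ∈ farSet C z := hz ▸ h'.right_mem
  have hbz' : b ∈ farSet C z' := hz ▸ h.right_mem
  have ub := h.orthogonal b h.right_mem
  have ub' := h.orthogonal b' hb'z
  obtain ⟨k, hk, hu⟩ := hC.exists_pos_smul_eq h.left_mem.1 h.right_mem.1 h'.right_mem.1
    hab hab' hbb h.ne_zero h'.ne_zero ub ub'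
    (h'.orthogonal b hbz') (h'.orthogonal b' h'.right_mem) h.recession h'.recession
  have t' : triple u' v' (b' - a) = k * triple u v' (b' - a) := by
    rw [hu]; simp [triple]; ring
  have hneg := h'.triple_neg
  rw [t'] at hneg
  have hneg' : triple u v' (b' - a) < 0 := by
    by_contra! hle
    exact absurd hneg (not_lt.2 (mul_nonneg hk.le hle))
  have p := h.inner_pos b' hb'z hab'.symm (Ne.symm hbb)
  have p' := h'.inner_pos b hbz' hab.symm hbb
  refine p.ne' (inner_eq_zero_of_same_orientation (e := u) (w₁ := b - a) (w₂ := b' - a)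
    (v₁ := v) (v₂ := v') (by rw [real_inner_comm]; exact ub) (by rw [real_inner_comm]; exact ub')
    h.inner_edge h'.inner_edge ?_ p.le p'.le)
  rw [triple_swap_left, triple_swap_left u v', neg_mul_neg]
  exact mul_pos_of_neg_of_neg h.triple_neg hneg'

/-- The side on which an upward edge lies in the corner at its lower end. -/
lemma IsOrientedEnd.triple_sign {C : Set E3} {r : ℝ} {a b d z u v : E3}
    (h : IsOrientedEnd C r a b z u v) (hd : d ∈ farSet C z) (hda : d ≠ a) (hdb : d ≠ b) :
    triple u (d - a) (b - a) < 0 := by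
  have h1 : triple u v (b - a) * triple u (d - a) (b - a) =
      ⟪u, u⟫ * ⟪v, d - a⟫ * ⟪b - a, b - a⟫ := by
    rw [triple_mul_triple, h.orthogonal d hd, h.orthogonal b h.right_mem, h.inner_edge]; ring
  have hba : b - a ≠ 0 := fun h0 => h.triple_neg.ne (by simp [h0, triple])
  have h2 := mul_pos (mul_pos (inner_self_pos_of_ne_zero h.ne_zero) (h.inner_pos d hd hda hdb))
    (inner_self_pos_of_ne_zero hba)
  rw [← h1] at h2
  exact neg_of_mul_pos_right h2 h.triple_neg.le

lemma mem_vectorSpan_orthogonal_iff {S : Set E3} {a d : E3} (ha : a ∈ S) :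
    d ∈ (vectorSpan ℝ S)ᗮ ↔ ∀ t ∈ S, ⟪d, t - a⟫ = 0 := by
  rw [vectorSpan_eq_span_vsub_set_right ℝ ha, Submodule.mem_orthogonal']
  refine ⟨fun h t ht => h _ (Submodule.subset_span ⟨t, ht, rfl⟩), fun h x hx => ?_⟩
  induction hx using Submodule.span_induction with
  | mem x hx => obtain ⟨t, ht, rfl⟩ := hx; exact h t ht
  | zero => exact inner_zero_right _
  | add x y _ _ hx hy => rw [inner_add_right, hx, hy, add_zero]
  | smul k x _ hx => rw [real_inner_smul_right, hx, mul_zero]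

lemma exists_pos_farSet_add_smul_eq {C : Set E3} (hf : C.Finite) {z a d : E3}
    (ha : a ∈ farSet C z) (hd : ∀ t ∈ farSet C z, ⟪d, t - a⟫ = 0) :
    ∃ s : ℝ, 0 < s ∧ farSet C (z + s • d) = farSet C z := by
  have h : ∀ c ∈ C \ farSet C z, ∀ᶠ s : ℝ in nhdsWithin 0 (Ioi 0),
      normPow z c - 2 * s * ⟪d, c⟫ < normPow z a - 2 * s * ⟪d, a⟫ := by
    intro c hc
    refine Filter.Eventually.filter_mono nhdsWithin_le_nhds ?_
    refine ContinuousAt.eventually_lt (by fun_prop) (by fun_prop) ?_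
    simpa using normPow_lt_of_notMem_farSet ha hc.1 hc.2
  obtain ⟨s, hs, h0⟩ := ((((hf.subset sdiff_subset).eventually_all).2 h).and
    self_mem_nhdsWithin).exists
  refine ⟨s, h0, farSet_eq_of ha (farSet_subset C z) (fun t ht => ?_) (fun c hc hcf => ?_)⟩
  · have := hd t ht
    rw [inner_sub_right] at this
    rw [normPow_add_smul, normPow_add_smul, normPow_eq_of_mem_farSet ht ha]
    linear_combination (-2 * s) * this
  · rw [normPow_add_smul, normPow_add_smul]
    exact hs c ⟨hc, hcf⟩

lemma vectorSpan_vorF {C : Set E3} (hf : C.Finite) (hne : C.Nonempty) (z : E3) :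
    vectorSpan ℝ (vorF C (farSet C z)) = (vectorSpan ℝ (farSet C z))ᗮ := by
  obtain ⟨a, ha⟩ := farSet_nonempty hf hne z
  have hz : z ∈ vorF C (farSet C z) := rfl
  apply le_antisymm
  · rw [vectorSpan_eq_span_vsub_set_right ℝ hz, Submodule.span_le]
    rintro _ ⟨x, hx, rfl⟩
    have hx : farSet C z = farSet C x := hx
    refine (mem_vectorSpan_orthogonal_iff ha).2 fun t ht => ?_
    have h1 := normPow_eq_of_mem_farSet ht ha
    have h2 := normPow_eq_of_mem_farSet (hx ▸ ht) (hx ▸ ha)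
    simp only [normPow] at h1 h2
    change ⟪x - z, t - a⟫ = 0
    rw [inner_sub_left, inner_sub_right, inner_sub_right]
    linarith
  · intro d hd
    obtain ⟨s, hs, h⟩ := exists_pos_farSet_add_smul_eq hf ha
      ((mem_vectorSpan_orthogonal_iff ha).1 hd)
    have h1 : z + s • d ∈ vorF C (farSet C z) := h.symm
    have h2 := vsub_mem_vectorSpan ℝ h1 hz
    rw [vsub_eq_sub, add_sub_cancel_left] at h2
    exact (Submodule.smul_mem_iff _ hs.ne').1 h2

lemma setDim_vorF_add_finrank {C : Set E3} (hf : C.Finite) (hne : C.Nonempty) (z : E3) :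
    setDim (vorF C (farSet C z)) + Module.finrank ℝ (vectorSpan ℝ (farSet C z)) = 3 := by
  rw [setDim, direction_affineSpan, vectorSpan_vorF hf hne, add_comm,
    Submodule.finrank_add_finrank_orthogonal]
  simp

lemma setDim_vorF_eq_one {C : Set E3} {z a b c u : E3} (hf : C.Finite)
    (ha : a ∈ farSet C z) (hb : b ∈ farSet C z) (hc : c ∈ farSet C z)
    (hcol : ¬ Collinear ℝ {a, b, c}) (hu : u ≠ 0) (hu₀ : ∀ t ∈ farSet C z, ⟪u, t - a⟫ = 0) :
    setDim (vorF C (farSet C z)) = 1 := by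
  have h := setDim_vorF_add_finrank hf ⟨a, ha.1⟩ z
  have h2 : ¬ Module.finrank ℝ (vectorSpan ℝ (farSet C z)) ≤ 1 := by
    rw [← collinear_iff_finrank_le_one]
    refine fun hcol' => hcol (hcol'.subset ?_)
    rintro t (rfl | rfl | rfl) <;> assumption
  have h3 : 1 ≤ setDim (vorF C (farSet C z)) := by
    rw [setDim, direction_affineSpan, vectorSpan_vorF hf ⟨a, ha.1⟩, Nat.one_le_iff_ne_zero]
    intro h0
    have := Submodule.finrank_eq_zero.1 h0
    exact hu ((Submodule.mem_bot ℝ).1 (this ▸ (mem_vectorSpan_orthogonal_iff ha).2 hu₀))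
  omega

lemma exists_three_of_setDim_vorF_eq_one {C : Set E3} {z : E3} (hf : C.Finite) (hne : C.Nonempty)
    (h : setDim (vorF C (farSet C z)) = 1) :
    ∃ a ∈ farSet C z, ∃ b ∈ farSet C z, ∃ c ∈ farSet C z, a ≠ b ∧ a ≠ c ∧ b ≠ c := by
  have h2 := setDim_vorF_add_finrank hf hne z
  obtain ⟨a, ha⟩ := farSet_nonempty hf hne z
  have hcol {b : E3} : ¬ farSet C z ⊆ {a, b} := by
    intro hsub
    have := ((collinear_pair ℝ a b).subset hsub).finrank_le_one
    omega
  obtain ⟨b, hb, hab⟩ := not_subset.1 (hcol (b := a))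
  obtain ⟨c, hc, hac⟩ := not_subset.1 (hcol (b := b))
  simp only [mem_insert_iff, mem_singleton_iff, not_or] at hab hac
  exact ⟨a, ha, b, hb, c, hc, Ne.symm hab.1, Ne.symm hac.1, Ne.symm hac.2⟩

lemma BasicCenters.exists_pair_of_setDim_vorF_eq_two {C : Set E3} {r : ℝ} {z : E3}
    (hC : BasicCenters C r) (hne : C.Nonempty) (h : setDim (vorF C (farSet C z)) = 2) :
    ∃ a b, a ≠ b ∧ farSet C z = {a, b} := by
  have h2 := setDim_vorF_add_finrank hC.finite hne z
  obtain ⟨a, ha⟩ := farSet_nonempty hC.finite hne z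
  have hcol : Collinear ℝ (farSet C z) := collinear_iff_finrank_le_one.2 (by omega)
  have hsub : ¬ farSet C z ⊆ {a} := by
    intro hsub
    have h0 : vectorSpan ℝ (farSet C z) = ⊥ := by
      rw [← le_bot_iff, ← vectorSpan_singleton ℝ a]
      exact vectorSpan_mono ℝ hsub
    rw [h0, finrank_bot] at h2
    omega
  obtain ⟨b, hb, hab⟩ := not_subset.1 hsub
  have hab : a ≠ b := Ne.symm hab
  refine ⟨a, b, hab, Subset.antisymm (fun c hc => ?_) ?_⟩
  · by_contra hcab
    simp only [mem_insert_iff, mem_singleton_iff, not_or] at hcab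
    refine hC.not_collinear a ha.1 b hb.1 c hc.1 hab (Ne.symm hcab.1) (Ne.symm hcab.2)
      (hcol.subset ?_)
    rintro t (rfl | rfl | rfl) <;> assumption
  · rintro t (rfl | rfl) <;> assumption

lemma frontier_ballPoly_subset {C : Set E3} {r : ℝ} (hf : C.Finite) {z : E3}
    (hz : z ∈ frontier (ballPoly C r)) : ∀ a ∈ farSet C z, r ≤ dist z a := by
  intro a ha
  by_contra! hlt
  refine hz.2 (mem_interior.2 ⟨⋂ c ∈ C, ball c r, ?_, ?_, ?_⟩)
  · exact iInter₂_mono fun c _ => ball_subset_closedBall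
  · exact hf.isOpen_biInter fun c _ => isOpen_ball
  · exact mem_iInter₂.2 fun c hc => (ha.2 c hc).trans_lt hlt

lemma mem_frontier_ballPoly {C : Set E3} {r : ℝ} (hr : 0 < r) {z a : E3}
    (ha : a ∈ farSet C z) (hz : dist z a = r) : z ∈ frontier (ballPoly C r) := by
  refine ⟨subset_closure (mem_iInter₂.2 fun c hc => (ha.2 c hc).trans_eq hz), fun hi => ?_⟩
  have h1 := interior_mono (iInter₂_subset a ha.1 : ballPoly C r ⊆ closedBall a r) hi
  rw [interior_closedBall _ hr.ne', mem_ball] at h1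
  exact h1.ne hz

lemma not_collinear_of_extremePoints {C : Set E3} (hC : C = extremePoints ℝ (convexHull ℝ C))
    {a b c : E3} (ha : a ∈ C) (hb : b ∈ C) (hc : c ∈ C) (hab : a ≠ b) (hac : a ≠ c)
    (hbc : b ≠ c) : ¬ Collinear ℝ {a, b, c} := by
  have key {x y w : E3} (hx : x ∈ C) (hy : y ∈ C) (hw : w ∈ C) (hxy : x ≠ y) (hyw : y ≠ w) :
      ¬ Wbtw ℝ x y w := by
    intro h
    rw [hC, mem_extremePoints_iff_forall_segment] at hy
    rcases hy.2 x (subset_convexHull ℝ C hx) w (subset_convexHull ℝ C hw)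
      (mem_segment_iff_wbtw.2 h) with h | h
    · exact hxy h
    · exact hyw h.symm
  intro h
  rcases h.wbtw_or_wbtw_or_wbtw with h | h | h
  · exact key ha hb hc hab hbc h
  · exact key hb hc ha hbc hac.symm h
  · exact key hc ha hb hac.symm hab h

lemma IsBasicBallPolyhedron.basicCenters {C : Set E3} {r : ℝ} (h : IsBasicBallPolyhedron C r) :
    BasicCenters C r := by
  obtain ⟨hr, hf, -, -, hdim, hext, hpos, hv⟩ := h
  refine ⟨hf, hr, fun a ha u hu => ?_, fun a ha b hb c hc =>
    not_collinear_of_extremePoints hext ha hb hc, fun v hvv c hc => ?_, hpos.1⟩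
  · have htop : vectorSpan ℝ C = ⊤ := by
      apply Submodule.eq_top_of_finrank_eq
      rw [setDim, affineSpan_convexHull, direction_affineSpan] at hdim
      rw [hdim]; simp
    have := (mem_vectorSpan_orthogonal_iff ha).2 hu
    rw [htop, Submodule.top_orthogonal_eq_bot] at this
    exact (Submodule.mem_bot ℝ).1 this
  · have h1 := interior_mono (iInter₂_subset c hc : ballPoly C r ⊆ closedBall c r)
      (hv _ (farSet_subset C v) v hvv)
    rwa [interior_closedBall _ hr.ne', mem_ball] at h1

lemma exists_injOn_inner {C : Set E3} (hf : C.Finite) :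
    ∃ e : E3, InjOn (fun c => ⟪e, c⟫) C := by
  have := hf.to_subtype
  obtain ⟨e, he⟩ := Module.Dual.exists_forall_ne_zero_of_forall_exists (K := ℝ) (M := E3)
    (fun i : {p : C × C // p.1 ≠ p.2} => innerₗ E3 ((i.1.1 : E3) - i.1.2)) fun i => by
      refine ⟨(i.1.1 : E3) - i.1.2, ?_⟩
      rw [innerₗ_apply_apply, inner_self_ne_zero, sub_ne_zero]
      exact fun h => i.2 (Subtype.ext h)
  refine ⟨e, fun a ha b hb hab => ?_⟩
  by_contra hne
  refine he ⟨(⟨a, ha⟩, ⟨b, hb⟩), fun h => hne (congrArg Subtype.val h)⟩ ?_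
  have hab : ⟪e, a⟫ = ⟪e, b⟫ := hab
  rw [innerₗ_apply_apply, real_inner_comm, inner_sub_right, hab, sub_self]

/-- The points of `C` that are neither lowest nor highest with respect to the height function
`e`. -/
def middle (C : Set E3) (e : E3) : Set E3 :=
  {c | c ∈ C ∧ (∃ a ∈ C, ⟪e, a⟫ < ⟪e, c⟫) ∧ ∃ b ∈ C, ⟪e, c⟫ < ⟪e, b⟫}

lemma ncard_middle_add_two_le {C : Set E3} (hf : C.Finite) (h2 : 2 ≤ C.ncard) {e : E3}
    (he : InjOn (fun c => ⟪e, c⟫) C) : (middle C e).ncard + 2 ≤ C.ncard := by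
  have hne : C.Nonempty := nonempty_of_ncard_ne_zero (by omega)
  obtain ⟨lo, hlo, hmin⟩ := exists_min_image C (fun c => ⟪e, c⟫) hf hne
  obtain ⟨hi, hhi, hmax⟩ := exists_max_image C (fun c => ⟪e, c⟫) hf hne
  have hne : lo ≠ hi := by
    rintro rfl
    have hsub : C ⊆ {lo} := fun c hc => he hc hlo (le_antisymm (hmax c hc) (hmin c hc))
    have := ncard_le_ncard hsub (finite_singleton lo)
    rw [ncard_singleton] at this
    omega
  have hpair : ({lo, hi} : Set E3) ⊆ C := by
    rintro t (rfl | rfl) <;> assumption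
  have hsub : middle C e ⊆ C \ {lo, hi} := by
    rintro c ⟨hc, ⟨a, ha, hac⟩, b, hb, hcb⟩
    refine ⟨hc, ?_⟩
    rintro (rfl | rfl)
    · exact absurd (hmin a ha) (not_le.2 hac)
    · exact absurd (hmax b hb) (not_le.2 hcb)
  have h3 := ncard_le_ncard hsub (hf.subset sdiff_subset)
  have h4 := ncard_sdiff_add_ncard_of_subset hpair hf
  rw [ncard_pair hne] at h4
  omega

lemma ncard_le_ncard_of_rel {α β : Type*} {A : Set α} {B : Set β} (hB : B.Finite)
    (R : α → β → Prop) (h : ∀ x ∈ A, ∃ y ∈ B, R x y)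
    (huniq : ∀ x x' y, R x y → R x' y → x = x') : A.ncard ≤ B.ncard := by
  rcases A.eq_empty_or_nonempty with rfl | ⟨x₀, hx₀⟩
  · simp
  have : Nonempty β := ⟨(h x₀ hx₀).choose⟩
  choose! f hf hR using h
  exact ncard_le_ncard_of_injOn f hf
    (fun x hx x' hx' hxx => huniq x x' (f x) (hR x hx) (hxx ▸ hR x' hx')) hB

lemma IsFacetCorner.mem_middle {C : Set E3} {e c a b z u : E3}
    (h : IsFacetCorner C e c a b z u) : c ∈ middle C e := by
  refine ⟨h.mem.1, ⟨a, h.lower_mem.1, ?_⟩, b, h.upper_mem.1, ?_⟩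
  · have := h.lower
    rw [inner_sub_right] at this
    linarith
  · have := h.upper
    rw [inner_sub_right] at this
    linarith

/-- The label sets of the faces of the ball polyhedron whose Voronoi faces have dimension `k`. -/
def faces (C : Set E3) (r : ℝ) (k : ℕ) : Set (Set E3) :=
  {S | S ⊆ C ∧ (vorF C S ∩ frontier (ballPoly C r)).Nonempty ∧ setDim (vorF C S) = k}

lemma finite_faces {C : Set E3} (hf : C.Finite) (r : ℝ) (k : ℕ) : (faces C r k).Finite :=
  hf.finite_subsets.subset fun _ h => h.1

lemma exists_of_mem_faces {C S : Set E3} {r : ℝ} {k : ℕ} (hf : C.Finite) (hS : S ∈ faces C r k) :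
    ∃ z, S = farSet C z ∧ setDim (vorF C (farSet C z)) = k ∧ ∀ a ∈ farSet C z, r ≤ dist z a := by
  obtain ⟨-, ⟨z, hz, hzf⟩, hk⟩ := hS
  have hz : S = farSet C z := hz
  exact ⟨z, hz, hz ▸ hk, frontier_ballPoly_subset hf hzf⟩

namespace BasicCenters

variable {C : Set E3} {r : ℝ}

lemma exists_isFacetCorner (hC : BasicCenters C r) (hne : C.Nonempty) {e : E3}
    (he : InjOn (fun c => ⟪e, c⟫) C) {S : Set E3} (hS : S ∈ faces C r 1) :
    ∃ c a b z u, IsFacetCorner C e c a b z u ∧ farSet C z = S := by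
  obtain ⟨z, rfl, hdim, hz⟩ := exists_of_mem_faces hC.finite hS
  have key {a c b : E3} (ha : a ∈ farSet C z) (hc : c ∈ farSet C z) (hb : b ∈ farSet C z)
      (hac : ⟪e, a⟫ < ⟪e, c⟫) (hcb : ⟪e, c⟫ < ⟪e, b⟫) :
      ∃ c a b z' u, IsFacetCorner C e c a b z' u ∧ farSet C z' = farSet C z := by
    obtain ⟨u, -, hu, hrec, hort, -⟩ := hC.exists_recession hc ha hb (by rintro rfl; simp at hac)
      (by rintro rfl; simp at hcb) (by rintro rfl; exact lt_asymm hac hcb) (hz c hc)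
    refine ⟨c, a, b, z, u, ⟨hc, ha, hb, ?_, ?_, hu, hrec, hort⟩, rfl⟩
    · rw [inner_sub_right]; linarith
    · rw [inner_sub_right]; linarith
  obtain ⟨a, ha, b, hb, c, hc, hab, hac, hbc⟩ :=
    exists_three_of_setDim_vorF_eq_one hC.finite hne hdim
  have hab' : ⟪e, a⟫ ≠ ⟪e, b⟫ := fun h => hab (he ha.1 hb.1 h)
  have hac' : ⟪e, a⟫ ≠ ⟪e, c⟫ := fun h => hac (he ha.1 hc.1 h)
  have hbc' : ⟪e, b⟫ ≠ ⟪e, c⟫ := fun h => hbc (he hb.1 hc.1 h)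
  rcases hab'.lt_or_gt with h1 | h1 <;> rcases hac'.lt_or_gt with h2 | h2 <;>
    rcases hbc'.lt_or_gt with h3 | h3
  · exact key ha hb hc h1 h3
  · exact key ha hc hb h2 h3
  · exact absurd (h1.trans h3) (lt_asymm h2)
  · exact key hc ha hb h2 h1
  · exact key hb ha hc h1 h2
  · exact absurd (h3.trans h1) (lt_asymm h2 ·)
  · exact key hb hc ha h3 h2
  · exact key hc hb ha h3 h1

lemma ncard_faces_one_le (hC : BasicCenters C r) (hne : C.Nonempty) {e : E3}
    (he : InjOn (fun c => ⟪e, c⟫) C) : (faces C r 1).ncard ≤ 2 * (middle C e).ncard := by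
  have hfin : (middle C e).Finite := hC.finite.subset fun _ h => h.1
  let R (σ : ℝ) (S : Set E3) (c : E3) : Prop := ∃ a b z u, IsFacetCorner C e c a b z u ∧
    farSet C z = S ∧ 0 < σ * triple u (a - c) (b - c)
  have hR (σ : ℝ) : {S | S ∈ faces C r 1 ∧ ∃ c, R σ S c}.ncard ≤ (middle C e).ncard := by
    refine ncard_le_ncard_of_rel hfin (R σ) ?_ ?_
    · rintro S ⟨-, c, h⟩
      obtain ⟨a, b, z, u, hcor, -⟩ := id h
      exact ⟨c, hcor.mem_middle, h⟩
    · rintro _ _ c ⟨a, b, z, u, h, rfl, hs⟩ ⟨a', b', z', u', h', rfl, hs'⟩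
      refine hC.farSet_eq_of_isFacetCorner h h' ?_
      have h1 := mul_pos hs hs'
      have h2 : 0 < σ ^ 2 := by
        have : σ ≠ 0 := by rintro rfl; simp at hs
        positivity
      refine (mul_pos_iff_of_pos_left h2).1 ?_
      linarith
  have hsub : faces C r 1 ⊆ {S | S ∈ faces C r 1 ∧ ∃ c, R 1 S c} ∪
      {S | S ∈ faces C r 1 ∧ ∃ c, R (-1) S c} := by
    intro S hS
    obtain ⟨c, a, b, z, u, h, hz⟩ := hC.exists_isFacetCorner hne he hS
    rcases (h.triple_ne_zero hC).lt_or_gt with hs | hs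
    · exact Or.inr ⟨hS, c, a, b, z, u, h, hz, by linarith⟩
    · exact Or.inl ⟨hS, c, a, b, z, u, h, hz, by linarith⟩
  have h1 := ncard_le_ncard hsub ((finite_faces hC.finite r 1).subset (by
    rintro S (h | h) <;> exact h.1))
  have h2 := ncard_union_le {S | S ∈ faces C r 1 ∧ ∃ c, R 1 S c}
    {S | S ∈ faces C r 1 ∧ ∃ c, R (-1) S c}
  have h3 := hR 1
  have h4 := hR (-1)
  omega

lemma farSet_mem_faces_one (hC : BasicCenters C r) {a b z u v : E3} (hab : a ≠ b)
    (h : IsOrientedEnd C r a b z u v) : farSet C z ∈ faces C r 1 := by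
  obtain ⟨c, hc, hac, hbc⟩ := h.exists_third
  exact ⟨farSet_subset C z, ⟨z, rfl, mem_frontier_ballPoly hC.pos h.left_mem h.dist_eq⟩,
    setDim_vorF_eq_one hC.finite h.left_mem h.right_mem hc
      (hC.not_collinear a h.left_mem.1 b h.right_mem.1 c hc.1 hab hac hbc) h.ne_zero h.orthogonal⟩

lemma exists_isOrientedEnd_of_mem_faces (hC : BasicCenters C r) (hne : C.Nonempty) {e : E3}
    (he : InjOn (fun c => ⟪e, c⟫) C) {S : Set E3} (hS : S ∈ faces C r 2) :
    ∃ a b z u v, ⟪e, a⟫ < ⟪e, b⟫ ∧ S = {a, b} ∧ IsOrientedEnd C r a b z u v := by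
  obtain ⟨y, rfl, hdim, hy⟩ := exists_of_mem_faces hC.finite hS
  obtain ⟨a, b, hab, hyab⟩ := hC.exists_pair_of_setDim_vorF_eq_two hne hdim
  have hay : a ∈ farSet C y := by simp [hyab]
  have hby : b ∈ farSet C y := by simp [hyab]
  rcases lt_or_gt_of_ne (fun h => hab (he hay.1 hby.1 h) : ⟪e, a⟫ ≠ ⟪e, b⟫) with h | h
  · obtain ⟨z, u, v, hend⟩ := hC.exists_isOrientedEnd hab hyab (hy a hay)
    exact ⟨a, b, z, u, v, h, hyab, hend⟩
  · rw [pair_comm] at hyab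
    obtain ⟨z, u, v, hend⟩ := hC.exists_isOrientedEnd hab.symm hyab (hy b hby)
    exact ⟨b, a, z, u, v, h, hyab, hend⟩

lemma ncard_faces_two_le (hC : BasicCenters C r) (hne : C.Nonempty) {e : E3}
    (he : InjOn (fun c => ⟪e, c⟫) C) :
    (faces C r 2).ncard ≤ (faces C r 1).ncard + (middle C e).ncard := by
  have hfin : (middle C e).Finite := hC.finite.subset fun _ h => h.1
  let R₁ (S T : Set E3) : Prop := ∃ a b z u v, ⟪e, a⟫ < ⟪e, b⟫ ∧ S = {a, b} ∧
    IsOrientedEnd C r a b z u v ∧ farSet C z = T ∧ ∀ t ∈ T, ⟪e, a⟫ ≤ ⟪e, t⟫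
  let R₂ (S : Set E3) (a : E3) : Prop := ∃ b d z u v, a ≠ b ∧ S = {a, b} ∧
    IsOrientedEnd C r a b z u v ∧ IsFacetCorner C e a d b z u ∧ triple u (d - a) (b - a) < 0
  have hR₁ : {S | S ∈ faces C r 2 ∧ ∃ T, R₁ S T}.ncard ≤ (faces C r 1).ncard := by
    refine ncard_le_ncard_of_rel (finite_faces hC.finite r 1) R₁ ?_ ?_
    · rintro S ⟨-, T, h⟩
      obtain ⟨a, b, z, u, v, hlt, -, hend, rfl, -⟩ := id h
      exact ⟨_, hC.farSet_mem_faces_one (by rintro rfl; exact hlt.false) hend, h⟩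
    · rintro _ _ T ⟨a, b, z, u, v, hlt, rfl, hend, rfl, hlow⟩
        ⟨a', b', z', u', v', hlt', rfl, hend', hz, hlow'⟩
      obtain rfl : a = a' := he hend.left_mem.1 hend'.left_mem.1
        (le_antisymm (hlow a' (hz ▸ hend'.left_mem)) (hlow' a hend.left_mem))
      rw [hC.eq_of_isOrientedEnd (by rintro rfl; exact hlt.false)
        (by rintro rfl; exact hlt'.false) hend hend' hz.symm]
  have hR₂ : {S | S ∈ faces C r 2 ∧ ∃ a, R₂ S a}.ncard ≤ (middle C e).ncard := by
    refine ncard_le_ncard_of_rel hfin R₂ ?_ ?_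
    · rintro S ⟨-, a, h⟩
      obtain ⟨b, d, z, u, v, -, -, -, hcor, -⟩ := id h
      exact ⟨a, hcor.mem_middle, h⟩
    · rintro _ _ a ⟨b, d, z, u, v, hab, rfl, hend, hcor, hs⟩
        ⟨b', d', z', u', v', hab', rfl, hend', hcor', hs'⟩
      rw [hC.eq_of_isOrientedEnd hab hab' hend hend'
        (hC.farSet_eq_of_isFacetCorner hcor hcor' (mul_pos_of_neg_of_neg hs hs'))]
  have hsub : faces C r 2 ⊆ {S | S ∈ faces C r 2 ∧ ∃ T, R₁ S T} ∪
      {S | S ∈ faces C r 2 ∧ ∃ a, R₂ S a} := by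
    intro S hS
    obtain ⟨a, b, z, u, v, hlt, hSab, hend⟩ := hC.exists_isOrientedEnd_of_mem_faces hne he hS
    have hab : a ≠ b := by rintro rfl; exact hlt.false
    by_cases hlow : ∀ t ∈ farSet C z, ⟪e, a⟫ ≤ ⟪e, t⟫
    · exact Or.inl ⟨hS, _, a, b, z, u, v, hlt, hSab, hend, rfl, hlow⟩
    · push Not at hlow
      obtain ⟨d, hd, hda⟩ := hlow
      refine Or.inr ⟨hS, a, b, d, z, u, v, hab, hSab, hend, ⟨hend.left_mem, hd, hend.right_mem,
        ?_, ?_, hend.ne_zero, hend.recession, hend.orthogonal⟩,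
        hend.triple_sign hd (by rintro rfl; exact hda.false)
          (by rintro rfl; exact lt_asymm hda hlt)⟩
      · rw [inner_sub_right]; linarith
      · rw [inner_sub_right]; linarith
  have h1 := ncard_le_ncard hsub ((finite_faces hC.finite r 2).subset (by
    rintro S (h | h) <;> exact h.1))
  have h2 := ncard_union_le {S | S ∈ faces C r 2 ∧ ∃ T, R₁ S T}
    {S | S ∈ faces C r 2 ∧ ∃ a, R₂ S a}
  omega

end BasicCenters

/-- a basic `r`-ball polyhedron in `E³` with `n` facets has at most `2n - 4`
vertices and at most `3n - 6` edges. -/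
theorem stmt15 (C : Set (EuclideanSpace ℝ (Fin 3))) (r : ℝ) (n : ℕ) (hn : 4 ≤ n)
    (hcard : C.ncard = n) (hC : IsBasicBallPolyhedron C r) :
    fFace C r 1 ≤ 2 * n - 4 ∧ fFace C r 2 ≤ 3 * n - 6 := by
  have hB := hC.basicCenters
  have hne : C.Nonempty := nonempty_of_ncard_ne_zero (by omega)
  obtain ⟨e, he⟩ := exists_injOn_inner hB.finite
  have hmid := ncard_middle_add_two_le hB.finite (by omega) he
  have h1 : fFace C r 1 ≤ _ := hB.ncard_faces_one_le hne he
  have h2 : fFace C r 2 ≤ fFace C r 1 + _ := hB.ncard_faces_two_le hne he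
  omega
end

section
/- Let d ≥ 2, n ≥ d+1, let τ_1 < τ_2 < … < τ_n be real numbers, and let C := {(τ_i, τ_i^2, …, τ_i^d) : 1 ≤ i ≤ n} ⊆ E^d be the corresponding set of points on the moment curve. Then there exists r₀ > 0 such that for all r ≥ r₀, P_{C,r} is a basic r-ball polyhedron with center-polytope conv(C), and for every 1 ≤ k ≤ d, f_{k−1}(P_{C,r}) equals the number of (d−k)-dimensional exposed faces of the cyclic polytope conv(C); in particular the upper bounds of the combinatorial upper bound theorem for basic r-ball polyhedra are sharp. -/
open Metric Set
open scoped RealInnerProductSpace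

/-- The point `(t, t^2, ..., t^d)` of the moment curve in `E^d`. -/
noncomputable def momentPt (d : ℕ) (t : ℝ) : EuclideanSpace ℝ (Fin d) :=
  (EuclideanSpace.equiv (Fin d) ℝ).symm (fun j => t ^ ((j : ℕ) + 1))

open Filter Topology

section FarthestPoint

variable {d : ℕ}

local notation "E" => EuclideanSpace ℝ (Fin d)

/-- `‖x - c‖ ^ 2 - ‖x‖ ^ 2`, an affine function of `x`. -/
noncomputable def relPower (x c : E) : ℝ := ‖c‖ ^ 2 - 2 * ⟪x, c⟫

theorem relPower_add_smul (x v c : E) (t : ℝ) :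
    relPower (x + t • v) c = relPower x c - 2 * t * ⟪v, c⟫ := by
  simp only [relPower, inner_add_left, real_inner_smul_left]; ring

theorem dist_sq_eq_relPower (x c : E) : dist x c ^ 2 = ‖x‖ ^ 2 + relPower x c := by
  rw [dist_eq_norm, norm_sub_sq_real, relPower]; ring

theorem dist_le_dist_iff_relPower (x c c' : E) :
    dist x c' ≤ dist x c ↔ relPower x c' ≤ relPower x c := by
  rw [← sq_le_sq₀ dist_nonneg dist_nonneg, dist_sq_eq_relPower, dist_sq_eq_relPower]
  simp

/-- `S` is the set of minimizers over `C` of a nonzero linear functional. -/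
def IsFacial (C S : Set E) : Prop :=
  S ⊆ C ∧ S.Nonempty ∧ ∃ u ≠ (0 : E), ∃ m : ℝ, (∀ c ∈ S, ⟪u, c⟫ = m) ∧ ∀ c ∈ C \ S, m < ⟪u, c⟫

theorem mem_vorF_iff {C S : Set E} (hSC : S ⊆ C) (hS : S.Nonempty) {x : E} :
    x ∈ vorF C S ↔
      ∃ m : ℝ, (∀ c ∈ S, relPower x c = m) ∧ ∀ c ∈ C \ S, relPower x c < m := by
  have key : x ∈ vorF C S ↔ ∀ c, c ∈ S ↔ c ∈ C ∧ ∀ c' ∈ C, relPower x c' ≤ relPower x c := by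
    simp only [vorF, Set.mem_ofPred_eq, Set.ext_iff, dist_le_dist_iff_relPower]
  rw [key]
  constructor
  · intro h
    obtain ⟨c₀, hc₀⟩ := hS
    have h₀ := ((h c₀).1 hc₀).2
    refine ⟨relPower x c₀, fun c hc => le_antisymm (h₀ c (hSC hc)) (((h c).1 hc).2 c₀ (hSC hc₀)),
      fun c hc => ?_⟩
    by_contra! hlt
    exact hc.2 ((h c).2 ⟨hc.1, fun c' hc' => (h₀ c' hc').trans hlt⟩)
  · rintro ⟨m, hm, hlt⟩ c
    have hle : ∀ c' ∈ C, relPower x c' ≤ m := fun c' hc' => by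
      by_cases hs : c' ∈ S
      · exact (hm c' hs).le
      · exact (hlt c' ⟨hc', hs⟩).le
    constructor
    · exact fun hc => ⟨hSC hc, fun c' hc' => (hle c' hc').trans (hm c hc).ge⟩
    · rintro ⟨hc, hmax⟩
      by_contra hs
      obtain ⟨c₀, hc₀⟩ := hS
      have := hmax c₀ (hSC hc₀)
      rw [hm c₀ hc₀] at this
      exact absurd (hlt c ⟨hc, hs⟩) this.not_gt

theorem nonempty_of_mem_vorF {C S : Set E} (hC : C.Finite) (hne : C.Nonempty) {x : E}
    (hx : x ∈ vorF C S) : S.Nonempty := by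
  obtain ⟨c, hc, h⟩ := C.exists_max_image (fun c => dist x c) hC hne
  have hx' : S = {c | c ∈ C ∧ ∀ c' ∈ C, dist x c' ≤ dist x c} := hx
  rw [hx']
  exact ⟨c, hc, h⟩

theorem inner_eq_of_mem_orthogonal_vectorSpan {S : Set E} {v : E} (hv : v ∈ (vectorSpan ℝ S)ᗮ)
    {c c' : E} (hc : c ∈ S) (hc' : c' ∈ S) : ⟪v, c⟫ = ⟪v, c'⟫ := by
  have := (Submodule.mem_orthogonal' _ v).1 hv _ (vsub_mem_vectorSpan ℝ hc hc')
  rw [vsub_eq_sub, inner_sub_right] at this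
  linarith

theorem mem_orthogonal_vectorSpan {S : Set E} {v : E}
    (h : ∀ c ∈ S, ∀ c' ∈ S, ⟪v, c⟫ = ⟪v, c'⟫) : v ∈ (vectorSpan ℝ S)ᗮ := by
  rw [vectorSpan, Submodule.mem_orthogonal']
  intro w hw
  induction hw using Submodule.span_induction with
  | mem w hw =>
    obtain ⟨a, ha, b, hb, rfl⟩ := hw
    simp only [vsub_eq_sub]
    rw [inner_sub_right, h a ha b hb, sub_self]
  | zero => exact inner_zero_right _
  | add a b _ _ ha hb => rw [inner_add_right, ha, hb, add_zero]
  | smul t a _ ha => rw [real_inner_smul_right, ha, mul_zero]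

theorem vectorSpan_vorF_s16 {C S : Set E} (hC : C.Finite) (hSC : S ⊆ C) (hS : S.Nonempty)
    (hV : (vorF C S).Nonempty) : vectorSpan ℝ (vorF C S) = (vectorSpan ℝ S)ᗮ := by
  apply le_antisymm
  · rw [vectorSpan, Submodule.span_le]
    rintro _ ⟨x, hx, y, hy, rfl⟩
    obtain ⟨a, ha, -⟩ := (mem_vorF_iff hSC hS).1 hx
    obtain ⟨b, hb, -⟩ := (mem_vorF_iff hSC hS).1 hy
    refine mem_orthogonal_vectorSpan fun c hc c' hc' => ?_
    have h1 := (ha c hc).trans (ha c' hc').symm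
    have h2 := (hb c hc).trans (hb c' hc').symm
    simp only [relPower] at h1 h2
    simp only [vsub_eq_sub, inner_sub_left]
    linarith
  · intro v hv
    obtain ⟨x, hx⟩ := hV
    obtain ⟨c₀, hc₀⟩ := hS
    obtain ⟨m, hm, hlt⟩ := (mem_vorF_iff hSC ⟨c₀, hc₀⟩).1 hx
    have hev : ∀ᶠ t : ℝ in 𝓝[>] 0, ∀ c ∈ C \ S,
        relPower x c - 2 * t * ⟪v, c⟫ < m - 2 * t * ⟪v, c₀⟫ := by
      rw [Filter.eventually_all_finite hC.sdiff]
      intro c hc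
      refine Filter.Eventually.filter_mono nhdsWithin_le_nhds ?_
      refine ContinuousAt.eventually_lt (by fun_prop) (by fun_prop) ?_
      simpa using hlt c hc
    obtain ⟨t, ht, ht0⟩ := (hev.and self_mem_nhdsWithin).exists
    have ht0 : (0 : ℝ) < t := ht0
    have hmem : x + t • v ∈ vorF C S := by
      refine (mem_vorF_iff hSC ⟨c₀, hc₀⟩).2 ⟨m - 2 * t * ⟪v, c₀⟫, fun c hc => ?_, fun c hc => ?_⟩
      · rw [relPower_add_smul, hm c hc, inner_eq_of_mem_orthogonal_vectorSpan hv hc hc₀]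
      · rw [relPower_add_smul]
        exact ht c hc
    have := vsub_mem_vectorSpan ℝ hmem hx
    rw [vsub_eq_sub, add_sub_cancel_left] at this
    exact (Submodule.smul_mem_iff _ ht0.ne').1 this

theorem setDim_convexHull (S : Set E) :
    setDim (convexHull ℝ S) = Module.finrank ℝ (vectorSpan ℝ S) := by
  rw [setDim, affineSpan_convexHull, direction_affineSpan]

theorem setDim_convexHull_add_setDim_vorF {C S : Set E} (hC : C.Finite) (hSC : S ⊆ C)
    (hS : S.Nonempty) (hV : (vorF C S).Nonempty) :
    setDim (convexHull ℝ S) + setDim (vorF C S) = d := by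
  rw [setDim_convexHull, setDim, direction_affineSpan, vectorSpan_vorF_s16 hC hSC hS hV,
    Submodule.finrank_add_finrank_orthogonal, finrank_euclideanSpace, Fintype.card_fin]

theorem exists_le_dist_of_mem_frontier {C : Set E} (hC : C.Finite) {r : ℝ} {x : E}
    (hx : x ∈ frontier (ballPoly C r)) : ∃ c ∈ C, r ≤ dist x c := by
  by_contra! h
  have hopen : IsOpen (⋂ c ∈ C, ball c r) := hC.isOpen_biInter fun c _ => isOpen_ball
  refine hx.2 (interior_maximal ?_ hopen ?_)
  · exact Set.iInter₂_mono fun c _ => ball_subset_closedBall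
  · exact Set.mem_iInter₂.2 h

theorem mem_interior_ballPoly {C : Set E} (hC : C.Finite) {r : ℝ} {x : E}
    (h : ∀ c ∈ C, dist x c < r) : x ∈ interior (ballPoly C r) := by
  have hopen : IsOpen (⋂ c ∈ C, ball c r) := hC.isOpen_biInter fun c _ => isOpen_ball
  refine interior_maximal ?_ hopen (Set.mem_iInter₂.2 h)
  exact Set.iInter₂_mono fun c _ => ball_subset_closedBall

theorem dist_le_of_mem_frontier {C : Set E} {r : ℝ} {x : E}
    (hx : x ∈ frontier (ballPoly C r)) {c : E} (hc : c ∈ C) : dist x c ≤ r := by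
  have hcl : IsClosed (ballPoly C r) := isClosed_biInter fun c _ => isClosed_closedBall
  exact Set.mem_iInter₂.1 (hcl.frontier_subset hx) c hc

theorem mem_frontier_ballPoly_s16 {C : Set E} {r : ℝ} (hr : r ≠ 0) {x : E}
    (hx : ∀ c ∈ C, dist x c ≤ r) {c : E} (hc : c ∈ C) (hxc : dist x c = r) :
    x ∈ frontier (ballPoly C r) := by
  refine ⟨subset_closure (Set.mem_iInter₂.2 hx), fun hi => ?_⟩
  have := interior_mono (Set.biInter_subset_of_mem hc : ballPoly C r ⊆ closedBall c r) hi
  rw [interior_closedBall c hr] at this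
  exact (mem_ball.1 this).ne hxc

theorem exists_mem_vorF_frontier {C S : Set E} (hC : C.Finite) (hSC : S ⊆ C)
    (hS : S.Nonempty) {u : E} (hu : u ≠ 0) {m : ℝ} (hm : ∀ c ∈ S, ⟪u, c⟫ = m)
    (hlt : ∀ c ∈ C \ S, m < ⟪u, c⟫) {y : E} {b : ℝ} (hy : ∀ c ∈ S, relPower y c = b) :
    ∀ᶠ r : ℝ in atTop, (vorF C S ∩ frontier (ballPoly C r)).Nonempty := by
  have hev : ∀ᶠ t : ℝ in atTop, ∀ c ∈ C \ S,
      relPower y c - 2 * t * ⟪u, c⟫ < b - 2 * t * m := by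
    rw [Filter.eventually_all_finite hC.sdiff]
    intro c hc
    have hpos : 0 < 2 * (⟪u, c⟫ - m) := by linarith [hlt c hc]
    filter_upwards [(tendsto_id.const_mul_atTop hpos).eventually_gt_atTop (relPower y c - b)]
      with t ht
    simp only [id] at ht
    linarith
  obtain ⟨t₀, ht₀⟩ := eventually_atTop.1 hev
  have hmem : ∀ t ≥ t₀, y + t • u ∈ vorF C S := fun t ht => by
    refine (mem_vorF_iff hSC hS).2 ⟨b - 2 * t * m, fun c hc => ?_, fun c hc => ?_⟩
    · rw [relPower_add_smul, hm c hc, hy c hc]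
    · rw [relPower_add_smul]
      exact ht₀ t ht c hc
  obtain ⟨c₀, hc₀⟩ := hS
  have htend : Tendsto (fun t : ℝ => dist (y + t • u) c₀) atTop atTop := by
    have h1 : Tendsto (fun t : ℝ => t * ‖u‖ - ‖y - c₀‖) atTop atTop :=
      tendsto_atTop_add_const_right _ _ (tendsto_id.atTop_mul_const (norm_pos_iff.2 hu))
    refine tendsto_atTop_mono (fun t => ?_) h1
    have h2 : ‖t • u‖ - ‖y - c₀‖ ≤ ‖t • u + (y - c₀)‖ := by
      have := norm_sub_norm_le (t • u) (-(y - c₀))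
      rwa [norm_neg, sub_neg_eq_add] at this
    have h3 : t * ‖u‖ ≤ ‖t • u‖ := by
      rw [norm_smul]
      exact mul_le_mul_of_nonneg_right (le_abs_self t) (norm_nonneg u)
    rw [dist_eq_norm, show y + t • u - c₀ = t • u + (y - c₀) by abel]
    linarith
  have hivt := (isPreconnected_Ici (a := t₀)).intermediate_value_Ici (l := atTop)
    (Set.mem_Ici.2 le_rfl) (le_principal_iff.2 (Ici_mem_atTop t₀))
    (f := fun t : ℝ => dist (y + t • u) c₀) (by fun_prop) htend
  filter_upwards [eventually_ge_atTop (dist (y + t₀ • u) c₀), eventually_gt_atTop 0] with r hr hr0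
  obtain ⟨t, ht, hdist⟩ := hivt hr
  have hx := hmem t ht
  refine ⟨_, hx, mem_frontier_ballPoly_s16 hr0.ne' (fun c hc => ?_) (hSC hc₀) hdist⟩
  have hx' : S = {c | c ∈ C ∧ ∀ c' ∈ C, dist (y + t • u) c' ≤ dist (y + t • u) c} := hx
  have h0 := hc₀
  rw [hx'] at h0
  exact (h0.2 c hc).trans hdist.le

theorem eventually_not_meets_frontier {C S : Set E} (hC : C.Finite)
    (hb : Bornology.IsBounded (vorF C S)) :
    ∀ᶠ r : ℝ in atTop, ¬ (vorF C S ∩ frontier (ballPoly C r)).Nonempty := by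
  obtain ⟨R, hR⟩ := isBounded_iff.1 (hb.union hC.isBounded)
  filter_upwards [eventually_gt_atTop R] with r hr
  rintro ⟨x, hx, hfr⟩
  obtain ⟨c, hc, hle⟩ := exists_le_dist_of_mem_frontier hC hfr
  exact absurd (hR (Or.inl hx) (Or.inr hc)) (not_le.2 (hr.trans_le hle))

theorem exists_minimizing_direction_of_unbounded {C S : Set E}
    (hb : ¬ Bornology.IsBounded (vorF C S)) :
    ∃ u ≠ (0 : E), ∀ c ∈ S, ∀ c' ∈ C, ⟪u, c⟫ ≤ ⟪u, c'⟫ := by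
  rw [isBounded_iff_forall_norm_le] at hb
  push Not at hb
  choose x hx hlt using fun n : ℕ => hb n
  have hpos : ∀ n, 0 < ‖x n‖ := fun n => (Nat.cast_nonneg n).trans_lt (hlt n)
  obtain ⟨u, hu, φ, hφ, htend⟩ := (isCompact_sphere (0 : E) 1).tendsto_subseq
    (x := fun n => ‖x n‖⁻¹ • x n) (fun n => by
      rw [mem_sphere_zero_iff_norm, norm_smul, norm_inv, norm_norm, inv_mul_cancel₀ (hpos n).ne'])
  have hinv : Tendsto (fun n => ‖x (φ n)‖⁻¹) atTop (𝓝 0) := by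
    refine Tendsto.comp (g := fun n => ‖x n‖⁻¹) (tendsto_inv_atTop_zero.comp ?_) hφ.tendsto_atTop
    exact tendsto_atTop_mono (fun n => (hlt n).le) tendsto_natCast_atTop_atTop
  refine ⟨u, fun h => ?_, fun c hc c' hc' => ?_⟩
  · simp [h] at hu
  · have hle : ∀ n, 2 * ⟪‖x (φ n)‖⁻¹ • x (φ n), c⟫ ≤
        2 * ⟪‖x (φ n)‖⁻¹ • x (φ n), c'⟫ + ‖x (φ n)‖⁻¹ * (‖c‖ ^ 2 - ‖c'‖ ^ 2) := fun n => by
      have hmem : S = {c | c ∈ C ∧ ∀ c' ∈ C, dist (x (φ n)) c' ≤ dist (x (φ n)) c} := hx (φ n)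
      have h0 := hc
      rw [hmem] at h0
      have h1 := (dist_le_dist_iff_relPower _ _ _).1 (h0.2 c' hc')
      simp only [relPower] at h1
      have h2 := mul_le_mul_of_nonneg_left h1 (inv_nonneg.2 (norm_nonneg (x (φ n))))
      rw [real_inner_smul_left, real_inner_smul_left]
      linarith
    have hl : Tendsto (fun n => 2 * ⟪‖x (φ n)‖⁻¹ • x (φ n), c⟫) atTop (𝓝 (2 * ⟪u, c⟫)) :=
      (htend.inner tendsto_const_nhds).const_mul 2
    have hr : Tendsto (fun n => 2 * ⟪‖x (φ n)‖⁻¹ • x (φ n), c'⟫ +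
        ‖x (φ n)‖⁻¹ * (‖c‖ ^ 2 - ‖c'‖ ^ 2)) atTop
        (𝓝 (2 * ⟪u, c'⟫ + 0 * (‖c‖ ^ 2 - ‖c'‖ ^ 2))) :=
      ((htend.inner tendsto_const_nhds).const_mul 2).add (hinv.mul_const _)
    have := le_of_tendsto_of_tendsto' hl hr hle
    linarith

/-- Every real function on the intersection of `C` with a hyperplane extends to an affine
function. -/
def InterpolatesOnHyperplanes (C : Set E) : Prop :=
  ∀ u ≠ (0 : E), ∀ m : ℝ, ∀ f : E → ℝ, ∃ w : E, ∃ b : ℝ,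
    ∀ c ∈ C, ⟪u, c⟫ = m → ⟪w, c⟫ = b + f c

theorem IsFacial.of_minimizing {C S : Set E} (hC : C.Finite) (hI : InterpolatesOnHyperplanes C)
    (hSC : S ⊆ C) (hS : S.Nonempty) {u : E} (hu : u ≠ 0)
    (hmin : ∀ c ∈ S, ∀ c' ∈ C, ⟪u, c⟫ ≤ ⟪u, c'⟫) : IsFacial C S := by
  classical
  obtain ⟨c₀, hc₀⟩ := hS
  set m := ⟪u, c₀⟫ with hm
  have hmS : ∀ c ∈ S, ⟪u, c⟫ = m := fun c hc =>
    le_antisymm (hmin c hc c₀ (hSC hc₀)) (hmin c₀ hc₀ c (hSC hc))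
  obtain ⟨w, b, hw⟩ := hI u hu m (fun c => if c ∈ S then 0 else 1)
  have hev : ∀ᶠ t : ℝ in 𝓝[>] 0, ∀ c ∈ C \ S, m + t * b < ⟪u + t • w, c⟫ := by
    rw [Filter.eventually_all_finite hC.sdiff]
    intro c hc
    rcases (hmin c₀ hc₀ c hc.1).eq_or_lt with h | h
    · filter_upwards [self_mem_nhdsWithin] with t ht
      have ht : (0 : ℝ) < t := ht
      rw [inner_add_left, real_inner_smul_left, ← h, hw c hc.1 h.symm, if_neg hc.2]
      linarith
    · refine Filter.Eventually.filter_mono nhdsWithin_le_nhds ?_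
      refine ContinuousAt.eventually_lt (by fun_prop) (by fun_prop) ?_
      simpa using h
  have hne : ∀ᶠ t : ℝ in 𝓝[>] 0, u + t • w ≠ 0 := by
    refine Filter.Eventually.filter_mono nhdsWithin_le_nhds ?_
    refine ContinuousAt.eventually_ne (by fun_prop) ?_
    simpa using hu
  obtain ⟨t, ht, hne⟩ := (hev.and hne).exists
  refine ⟨hSC, ⟨c₀, hc₀⟩, u + t • w, hne, m + t * b, fun c hc => ?_, ht⟩
  rw [inner_add_left, real_inner_smul_left, hmS c hc, hw c (hSC hc) (hmS c hc), if_pos hc]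
  ring

theorem eventually_meets_frontier_iff_isFacial {C S : Set E} (hC : C.Finite) (hne : C.Nonempty)
    (hI : InterpolatesOnHyperplanes C) (hSC : S ⊆ C) :
    ∀ᶠ r : ℝ in atTop, (vorF C S ∩ frontier (ballPoly C r)).Nonempty ↔ IsFacial C S := by
  by_cases h : IsFacial C S
  · obtain ⟨-, hS, u, hu, m, hm, hlt⟩ := id h
    obtain ⟨w, b, hw⟩ := hI u hu m (fun c => ‖c‖ ^ 2 / 2)
    filter_upwards [exists_mem_vorF_frontier hC hSC hS hu hm hlt (y := w) (b := -2 * b)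
      fun c hc => by rw [relPower, hw c (hSC hc) (hm c hc)]; ring] with r hr
    exact iff_of_true hr h
  · have hb : Bornology.IsBounded (vorF C S) := by
      by_contra hb
      have hV : (vorF C S).Nonempty := by
        rw [Set.nonempty_iff_ne_empty]
        rintro h0
        exact hb (h0 ▸ Bornology.isBounded_empty)
      have hS := nonempty_of_mem_vorF hC hne hV.choose_spec
      obtain ⟨u, hu, hmin⟩ := exists_minimizing_direction_of_unbounded hb
      exact h (IsFacial.of_minimizing hC hI hSC hS hu hmin)
    filter_upwards [eventually_not_meets_frontier hC hb] with r hr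
    exact iff_of_false hr h

/-- The face of `convexHull ℝ C` where `⟪u, ·⟫` is minimal is spanned by the minimizers in `C`. -/
theorem minimizers_convexHull {C : Set E} (hC : C.Finite) (u : E) :
    {x | x ∈ convexHull ℝ C ∧ ∀ y ∈ convexHull ℝ C, ⟪u, x⟫ ≤ ⟪u, y⟫} =
      convexHull ℝ {c | c ∈ C ∧ ∀ y ∈ C, ⟪u, c⟫ ≤ ⟪u, y⟫} := by
  set F := {x | x ∈ convexHull ℝ C ∧ ∀ y ∈ convexHull ℝ C, ⟪u, x⟫ ≤ ⟪u, y⟫} with hF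
  have hexp : IsExposed ℝ (convexHull ℝ C) F := fun _ =>
    ⟨-(innerSL ℝ u), by ext x; simp [hF]⟩
  have hconv : Convex ℝ F := hexp.convex (convex_convexHull ℝ C)
  apply Set.Subset.antisymm
  · have hcomp : IsCompact F := hexp.isCompact (hC.isCompact_convexHull ℝ)
    rw [← closure_convexHull_extremePoints hcomp hconv]
    refine closure_minimal (convexHull_mono fun c hc => ?_) ?_
    · exact ⟨extremePoints_convexHull_subset (hexp.isExtreme.extremePoints_subset_extremePoints hc),
        fun y hy => hc.1.2 y (subset_convexHull ℝ C hy)⟩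
    · exact ((hC.subset (Set.sep_subset C _)).isCompact_convexHull ℝ).isClosed
  · refine convexHull_min (fun c hc => ⟨subset_convexHull ℝ C hc.1, ?_⟩) hconv
    have hhalf : Convex ℝ {y | ⟪u, c⟫ ≤ ⟪u, y⟫} :=
      convex_halfSpace_ge (innerSL ℝ u).toLinearMap.isLinear _
    exact fun y hy => convexHull_min hc.2 hhalf hy

theorem IsFacial.minimizers_eq {C S : Set E} (hSC : S ⊆ C) (hS : S.Nonempty) {u : E} {m : ℝ}
    (hm : ∀ c ∈ S, ⟪u, c⟫ = m) (hlt : ∀ c ∈ C \ S, m < ⟪u, c⟫) :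
    {c | c ∈ C ∧ ∀ y ∈ C, ⟪u, c⟫ ≤ ⟪u, y⟫} = S := by
  ext c
  constructor
  · rintro ⟨hc, h⟩
    by_contra hs
    obtain ⟨c₀, hc₀⟩ := hS
    have := h c₀ (hSC hc₀)
    rw [hm c₀ hc₀] at this
    exact absurd (hlt c ⟨hc, hs⟩) this.not_gt
  · refine fun hc => ⟨hSC hc, fun y hy => ?_⟩
    rw [hm c hc]
    by_cases hs : y ∈ S
    · exact (hm y hs).ge
    · exact (hlt y ⟨hy, hs⟩).le

theorem IsFacial.convexHull_eq_minimizers {C S : Set E} (hC : C.Finite) (h : IsFacial C S) :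
    ∃ u : E, convexHull ℝ S =
        {x | x ∈ convexHull ℝ C ∧ ∀ y ∈ convexHull ℝ C, ⟪u, x⟫ ≤ ⟪u, y⟫} ∧
      S = {c | c ∈ C ∧ ∀ y ∈ C, ⟪u, c⟫ ≤ ⟪u, y⟫} := by
  obtain ⟨hSC, hS, u, -, m, hm, hlt⟩ := h
  have := IsFacial.minimizers_eq hSC hS hm hlt
  exact ⟨u, by rw [minimizers_convexHull hC, this], this.symm⟩

theorem IsFacial.isExposed {C S : Set E} (hC : C.Finite) (h : IsFacial C S) :
    IsExposed ℝ (convexHull ℝ C) (convexHull ℝ S) := by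
  obtain ⟨u, hu, -⟩ := h.convexHull_eq_minimizers hC
  exact fun _ => ⟨-(innerSL ℝ u), by rw [hu]; ext x; simp⟩

theorem IsFacial.convexHull_inter {C S : Set E} (hC : C.Finite) (h : IsFacial C S) :
    convexHull ℝ S ∩ C = S := by
  obtain ⟨u, hu, hS⟩ := h.convexHull_eq_minimizers hC
  apply Set.Subset.antisymm
  · rintro c ⟨hc, hcC⟩
    rw [hu] at hc
    rw [hS]
    exact ⟨hcC, fun y hy => hc.2 y (subset_convexHull ℝ C hy)⟩
  · exact Set.subset_inter (subset_convexHull ℝ S) h.1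

theorem exists_isFacial_of_isExposed {C F : Set E} (hC : C.Finite)
    (hF : IsExposed ℝ (convexHull ℝ C) F) (hne : F.Nonempty) (hprop : F ≠ convexHull ℝ C) :
    ∃ S, IsFacial C S ∧ convexHull ℝ S = F := by
  obtain ⟨l, hl⟩ := hF hne
  set u : E := -(InnerProductSpace.toDual ℝ E).symm l with hu
  have hlu : ∀ x, l x = -⟪u, x⟫ := fun x => by
    rw [hu, inner_neg_left, neg_neg, InnerProductSpace.toDual_symm_apply]
  have hFu : F = {x | x ∈ convexHull ℝ C ∧ ∀ y ∈ convexHull ℝ C, ⟪u, x⟫ ≤ ⟪u, y⟫} := by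
    rw [hl]; ext x; simp [hlu]
  have hS := hFu.trans (minimizers_convexHull hC u)
  have hSne : {c | c ∈ C ∧ ∀ y ∈ C, ⟪u, c⟫ ≤ ⟪u, y⟫}.Nonempty := by
    rw [hS] at hne
    exact convexHull_nonempty_iff.1 hne
  obtain ⟨c₀, hc₀, hmin⟩ := id hSne
  refine ⟨_, ⟨fun c hc => hc.1, hSne, u, fun h0 => hprop ?_, ⟪u, c₀⟫, fun c hc => ?_,
    fun c hc => ?_⟩, hS.symm⟩
  · rw [hFu]; ext x; simp [h0]
  · exact le_antisymm (hc.2 c₀ hc₀) (hmin c hc.1)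
  · by_contra! hle
    exact hc.2 ⟨hc.1, fun y hy => hle.trans (hmin y hy)⟩

theorem extremePoints_convexHull_eq {C : Set E} (hC : C.Finite)
    (hvert : ∀ c ∈ C, IsFacial C {c}) : C = Set.extremePoints ℝ (convexHull ℝ C) := by
  refine Set.Subset.antisymm (fun c hc => ?_) extremePoints_convexHull_subset
  have := ((hvert c hc).isExposed hC).isExtreme
  rwa [convexHull_singleton, isExtreme_singleton] at this

theorem not_mem_rConvexHull_of_meets_frontier {C : Set E} (hC : C.Finite) {r : ℝ} (hr : 0 < r)
    {c : E} (hc : c ∈ C) (h : (vorF C {c} ∩ frontier (ballPoly C r)).Nonempty) :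
    c ∉ rConvexHull r (C \ {c}) := by
  obtain ⟨x, hx, hfr⟩ := h
  obtain ⟨m, hm, hlt⟩ := (mem_vorF_iff (Set.singleton_subset_iff.2 hc)
    (Set.singleton_nonempty c)).1 hx
  have hlt' : ∀ c' ∈ C \ {c}, dist x c' < dist x c := fun c' hc' => by
    rw [← not_le, dist_le_dist_iff_relPower, not_le, hm c rfl]
    exact hlt c' hc'
  have hxc : dist x c = r := by
    refine le_antisymm (dist_le_of_mem_frontier hfr hc) ?_
    obtain ⟨c', hc', hle⟩ := exists_le_dist_of_mem_frontier hC hfr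
    by_cases heq : c' = c
    · rwa [← heq]
    · exact hle.trans (hlt' c' ⟨hc', heq⟩).le
  have hev : ∀ᶠ t : ℝ in 𝓝[>] 0, ∀ c' ∈ C \ {c}, dist (x + t • (x - c)) c' < r := by
    rw [Filter.eventually_all_finite hC.sdiff]
    intro c' hc'
    refine Filter.Eventually.filter_mono nhdsWithin_le_nhds ?_
    refine ContinuousAt.eventually_lt (by fun_prop) (by fun_prop) ?_
    simpa [hxc] using hlt' c' hc'
  obtain ⟨t, ht, ht0⟩ := (hev.and self_mem_nhdsWithin).exists
  have ht0 : (0 : ℝ) < t := ht0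
  intro hmem
  have := mem_closedBall'.1 (Set.mem_iInter₂.1 hmem (x + t • (x - c)) fun c' hc' =>
    mem_closedBall'.2 (ht c' hc').le)
  have hd : dist (x + t • (x - c)) c = (1 + t) * r := by
    rw [dist_eq_norm, show x + t • (x - c) - c = (1 + t) • (x - c) by module, norm_smul,
      ← dist_eq_norm, hxc, Real.norm_of_nonneg (by linarith)]
  rw [hd] at this
  nlinarith

theorem setDim_convexHull_eq {C : Set E}
    (hspan : ∀ (u : E) (m : ℝ), (∀ c ∈ C, ⟪u, c⟫ = m) → u = 0) (hne : C.Nonempty) :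
    setDim (convexHull ℝ C) = d := by
  have htop : vectorSpan ℝ C = ⊤ := by
    rw [← Submodule.orthogonal_eq_bot_iff, Submodule.eq_bot_iff]
    intro u hu
    obtain ⟨c₀, hc₀⟩ := hne
    exact hspan u ⟪u, c₀⟫ fun c hc => inner_eq_of_mem_orthogonal_vectorSpan hu hc hc₀
  rw [setDim_convexHull, htop, finrank_top, finrank_euclideanSpace, Fintype.card_fin]

theorem eventually_isBasicBallPolyhedron {C : Set E} (hd : 2 ≤ d) (hC : C.Finite)
    (hcard : d + 1 ≤ C.ncard) (hI : InterpolatesOnHyperplanes C)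
    (hspan : ∀ (u : E) (m : ℝ), (∀ c ∈ C, ⟪u, c⟫ = m) → u = 0)
    (hvert : ∀ c ∈ C, IsFacial C {c}) :
    ∀ᶠ r : ℝ in atTop, IsBasicBallPolyhedron C r := by
  have hne : C.Nonempty := Set.nonempty_of_ncard_ne_zero (by omega)
  have hmeet : ∀ᶠ r : ℝ in atTop, ∀ c ∈ C,
      (vorF C {c} ∩ frontier (ballPoly C r)).Nonempty := by
    rw [Filter.eventually_all_finite hC]
    intro c hc
    filter_upwards [eventually_meets_frontier_iff_isFacial hC hne hI
      (Set.singleton_subset_iff.2 hc)] with r hr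
    exact hr.2 (hvert c hc)
  have hvertices : ∀ᶠ r : ℝ in atTop, ∀ S ∈ C.powerset, ∀ v, vorF C S = {v} →
      v ∈ interior (ballPoly C r) := by
    rw [Filter.eventually_all_finite hC.powerset]
    intro S _
    by_cases h : ∃ v, vorF C S = {v}
    · obtain ⟨v, hv⟩ := h
      have : ∀ᶠ r : ℝ in atTop, ∀ c ∈ C, dist v c < r :=
        (Filter.eventually_all_finite hC).2 fun c _ => eventually_gt_atTop _
      filter_upwards [this] with r hr v' hv'
      rw [← Set.singleton_injective (hv.symm.trans hv')]
      exact mem_interior_ballPoly hC hr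
    · exact Filter.Eventually.of_forall fun r v hv => absurd ⟨v, hv⟩ h
  have hball : ∀ᶠ r : ℝ in atTop, C ⊆ ball 0 r := by
    filter_upwards [(Filter.eventually_all_finite hC).2 fun c _ =>
      eventually_gt_atTop (dist c 0)] with r hr c hc
    exact hr c hc
  filter_upwards [hmeet, hvertices, hball, eventually_gt_atTop 0] with r h1 h2 h3 hr
  exact ⟨hr, hC, hcard, hd, setDim_convexHull_eq hspan hne, extremePoints_convexHull_eq hC hvert,
    ⟨⟨0, h3⟩, fun c hc => not_mem_rConvexHull_of_meets_frontier hC hr hc (h1 c hc)⟩, h2⟩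

theorem eventually_fFace_eq {C : Set E} (hC : C.Finite) (hne : C.Nonempty)
    (hI : InterpolatesOnHyperplanes C)
    (hspan : ∀ (u : E) (m : ℝ), (∀ c ∈ C, ⟪u, c⟫ = m) → u = 0) :
    ∀ᶠ r : ℝ in atTop, ∀ k : ℕ, 1 ≤ k → k ≤ d →
      fFace C r k = {F : Set E | IsExposed ℝ (convexHull ℝ C) F ∧ F.Nonempty ∧
        setDim F = d - k}.ncard := by
  have hmeet : ∀ᶠ r : ℝ in atTop, ∀ S ∈ C.powerset,
      ((vorF C S ∩ frontier (ballPoly C r)).Nonempty ↔ IsFacial C S) := by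
    rw [Filter.eventually_all_finite hC.powerset]
    exact fun S hS => eventually_meets_frontier_iff_isFacial hC hne hI hS
  filter_upwards [hmeet] with r hr k hk hkd
  have hset : {S : Set E | S ⊆ C ∧ (vorF C S ∩ frontier (ballPoly C r)).Nonempty ∧
      setDim (vorF C S) = k} = {S | IsFacial C S ∧ setDim (convexHull ℝ S) = d - k} := by
    ext S
    constructor
    · rintro ⟨hSC, hV, hdim⟩
      have hF := (hr S hSC).1 hV
      have := setDim_convexHull_add_setDim_vorF hC hSC hF.2.1 (hV.mono Set.inter_subset_left)
      exact ⟨hF, by omega⟩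
    · rintro ⟨hF, hdim⟩
      have hV := (hr S hF.1).2 hF
      have := setDim_convexHull_add_setDim_vorF hC hF.1 hF.2.1 (hV.mono Set.inter_subset_left)
      exact ⟨hF.1, hV, by omega⟩
  have himage : {F : Set E | IsExposed ℝ (convexHull ℝ C) F ∧ F.Nonempty ∧ setDim F = d - k} =
      (fun S => convexHull ℝ S) '' {S | IsFacial C S ∧ setDim (convexHull ℝ S) = d - k} := by
    ext F
    constructor
    · rintro ⟨hexp, hFne, hdim⟩
      obtain ⟨S, hS, rfl⟩ := exists_isFacial_of_isExposed hC hexp hFne fun h => by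
        have := setDim_convexHull_eq hspan hne
        rw [h] at hdim
        omega
      exact ⟨S, ⟨hS, hdim⟩, rfl⟩
    · rintro ⟨S, ⟨hS, hdim⟩, rfl⟩
      exact ⟨hS.isExposed hC, hS.2.1.convexHull, hdim⟩
  rw [fFace, hset, himage, Set.InjOn.ncard_image]
  rintro S ⟨hS, -⟩ T ⟨hT, -⟩ h
  rw [← hS.convexHull_inter hC, ← hT.convexHull_inter hC]
  exact congrArg (· ∩ C) h

end FarthestPoint

section MomentCurve

open Polynomial

variable {d : ℕ}

theorem inner_momentPt (u : EuclideanSpace ℝ (Fin d)) (t : ℝ) :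
    ⟪u, momentPt d t⟫ = ∑ j : Fin d, u j * t ^ ((j : ℕ) + 1) := by
  simp [PiLp.inner_apply, momentPt, mul_comm]

theorem exists_inner_momentPt_eq_eval (p : ℝ[X]) (hp : p.natDegree ≤ d) :
    ∃ w : EuclideanSpace ℝ (Fin d), (∀ j : Fin d, w j = p.coeff (j + 1)) ∧
      ∀ t : ℝ, ⟪w, momentPt d t⟫ = p.eval t - p.coeff 0 := by
  refine ⟨WithLp.toLp 2 fun j => p.coeff (j + 1), fun j => rfl, fun t => ?_⟩
  rw [inner_momentPt, eval_eq_sum_range' (Nat.lt_succ_of_le hp), Finset.sum_range_succ']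
  simp [Fin.sum_univ_eq_sum_range (fun j => p.coeff (j + 1) * t ^ (j + 1))]

theorem card_le_of_inner_momentPt_eq {u : EuclideanSpace ℝ (Fin d)} (hu : u ≠ 0) {m : ℝ}
    {s : Finset ℝ} (hs : ∀ t ∈ s, ⟪u, momentPt d t⟫ = m) : s.card ≤ d := by
  by_contra! hlt
  set p : ℝ[X] := ∑ j : Fin d, C (u j) * X ^ ((j : ℕ) + 1) - C m with hp
  have hdeg : p.natDegree ≤ d := by
    refine (natDegree_sub_le_of_le (natDegree_sum_le_of_forall_le _ _ fun j _ => ?_)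
      (natDegree_C m).le).trans (max_le le_rfl (Nat.zero_le d))
    exact (natDegree_C_mul_X_pow_le _ _).trans j.2
  have hp0 := eq_zero_of_natDegree_lt_card_of_eval_eq_zero' p s
    (fun t ht => by simp [hp, eval_finsetSum, ← inner_momentPt, hs t ht]) (hdeg.trans_lt hlt)
  refine hu (PiLp.ext fun i => ?_)
  have hcoeff := congrArg (fun q => coeff q ((i : ℕ) + 1)) hp0
  simpa [hp, coeff_C, coeff_X_pow, Fin.val_inj] using hcoeff

theorem momentPt_injective (hd : 1 ≤ d) : Function.Injective (momentPt d) := fun s t h => by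
  simpa [momentPt] using congrArg (fun x : EuclideanSpace ℝ (Fin d) => x ⟨0, hd⟩) h

theorem interpolatesOnHyperplanes_momentPt {ι : Type*} [Finite ι] {tau : ι → ℝ}
    (htau : Function.Injective tau) :
    InterpolatesOnHyperplanes (Set.range fun i => momentPt d (tau i)) := by
  classical
  have := Fintype.ofFinite ι
  intro u hu m f
  set s : Finset ι := Finset.univ.filter fun i => ⟪u, momentPt d (tau i)⟫ = m with hs
  have hcard : s.card ≤ d := by
    rw [← Finset.card_image_of_injective s htau]
    refine card_le_of_inner_momentPt_eq hu (m := m) fun t ht => ?_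
    obtain ⟨i, hi, rfl⟩ := Finset.mem_image.1 ht
    exact (Finset.mem_filter.1 hi).2
  set p := Lagrange.interpolate s tau fun i => f (momentPt d (tau i)) with hp
  have hdeg : p.natDegree ≤ d := by
    refine natDegree_le_of_degree_le ((Lagrange.degree_interpolate_lt _ htau.injOn).le.trans ?_)
    exact_mod_cast hcard
  obtain ⟨w, -, hw⟩ := exists_inner_momentPt_eq_eval p hdeg
  refine ⟨w, -p.coeff 0, ?_⟩
  rintro _ ⟨i, rfl⟩ hi
  rw [hw, hp, Lagrange.eval_interpolate_at_node _ htau.injOn (by simpa [hs] using hi)]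
  ring

theorem isFacial_singleton_momentPt {ι : Type*} (hd : 2 ≤ d) (tau : ι → ℝ) (i : ι) :
    IsFacial (Set.range fun i => momentPt d (tau i)) {momentPt d (tau i)} := by
  have hmonic : ((X - C (tau i)) ^ 2 : ℝ[X]).Monic := (monic_X_sub_C _).pow 2
  have hnat : ((X - C (tau i)) ^ 2 : ℝ[X]).natDegree = 2 := by simp
  obtain ⟨w, hcoeff, hw⟩ := exists_inner_momentPt_eq_eval ((X - C (tau i)) ^ 2) (hnat.trans_le hd)
  refine ⟨Set.singleton_subset_iff.2 ⟨i, rfl⟩, Set.singleton_nonempty _, w, fun h => ?_,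
    -((X - C (tau i)) ^ 2).coeff 0, ?_, ?_⟩
  · have h1 := hcoeff ⟨1, hd⟩
    have h2 := hmonic.coeff_natDegree
    rw [hnat] at h2
    simp [h, h2] at h1
  · rintro _ rfl
    simp [hw]
  · rintro _ ⟨⟨j, rfl⟩, hj⟩
    have hne : tau j - tau i ≠ 0 := fun h => hj (by
      simp only [Set.mem_singleton_iff, sub_eq_zero.1 h])
    have := sq_pos_of_ne_zero hne
    simp only [hw, eval_pow, eval_sub, eval_X, eval_C]
    linarith

end MomentCurve

/-- for points on the moment curve and all sufficiently large `r`, `P_{C,r}`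
is a basic `r`-ball polyhedron attaining the upper bounds: `f_{k-1}(P_{C,r})` equals the
number of `(d-k)`-dimensional exposed faces of the cyclic polytope `conv C`. -/
theorem stmt16 {d n : ℕ} (hd : 2 ≤ d) (hn : d + 1 ≤ n)
    (tau : Fin n → ℝ) (htau : StrictMono tau) :
    ∃ r₀ > (0 : ℝ), ∀ r ≥ r₀,
      IsBasicBallPolyhedron (Set.range fun i => momentPt d (tau i)) r ∧
      ∀ k : ℕ, 1 ≤ k → k ≤ d →
        fFace (Set.range fun i => momentPt d (tau i)) r k =
          {F : Set (EuclideanSpace ℝ (Fin d)) |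
            IsExposed ℝ (convexHull ℝ (Set.range fun i => momentPt d (tau i))) F ∧
            F.Nonempty ∧ setDim F = d - k}.ncard := by
  have hd1 : 1 ≤ d := by omega
  set C := Set.range fun i => momentPt d (tau i) with hCdef
  have hC : C.Finite := Set.finite_range _
  have hcard : d + 1 ≤ C.ncard := by
    have := Set.ncard_range_of_injective ((momentPt_injective hd1).comp htau.injective)
    rw [Nat.card_fin] at this
    exact hn.trans_eq this.symm
  have hne : C.Nonempty := Set.nonempty_of_ncard_ne_zero (by omega)
  have hI : InterpolatesOnHyperplanes C := interpolatesOnHyperplanes_momentPt htau.injective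
  have hspan : ∀ (u : EuclideanSpace ℝ (Fin d)) (m : ℝ), (∀ c ∈ C, ⟪u, c⟫ = m) → u = 0 := by
    intro u m h
    by_contra hu
    have := card_le_of_inner_momentPt_eq hu (m := m) (s := Finset.univ.image tau) (by
      simpa [hCdef] using h)
    rw [Finset.card_image_of_injective _ htau.injective, Finset.card_univ, Fintype.card_fin] at this
    omega
  have hvert : ∀ c ∈ C, IsFacial C {c} := by
    rintro _ ⟨i, rfl⟩
    exact isFacial_singleton_momentPt hd tau i
  obtain ⟨r₀, hr₀⟩ := eventually_atTop.1
    ((eventually_isBasicBallPolyhedron hd hC hcard hI hspan hvert).and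
      (eventually_fFace_eq hC hne hI hspan))
  exact ⟨max r₀ 1, by positivity, fun r hr => hr₀ r ((le_max_left _ _).trans hr)⟩
end

section
/- Let d ≥ 2 and let P_{C,r} be a basic r-ball polyhedron in E^d with center-polytope conv(C), where |C| = n ≥ d+1. Then P_{C,r} has exactly n facets: for every c ∈ C one has V_{{c}} ∩ bd(P_{C,r}) ≠ ∅ and dim V_{{c}} = d, and conversely every S ⊆ C with V_S ∩ bd(P_{C,r}) ≠ ∅ and dim V_S = d is a singleton {c} with c ∈ C; in particular f_{d−1}(P_{C,r}) = n. -/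
open Metric Set
open scoped RealInnerProductSpace

theorem mem_vorF {d : ℕ} {C S : Set (EuclideanSpace ℝ (Fin d))} {x : EuclideanSpace ℝ (Fin d)} :
    x ∈ vorF C S ↔ S = {c | c ∈ C ∧ ∀ c' ∈ C, dist x c' ≤ dist x c} :=
  Iff.rfl

theorem mem_vorF_singleton {d : ℕ} {C : Set (EuclideanSpace ℝ (Fin d))}
    {c x : EuclideanSpace ℝ (Fin d)} (hc : c ∈ C) :
    x ∈ vorF C {c} ↔ ∀ c' ∈ C, c' ≠ c → dist x c' < dist x c := by
  rw [mem_vorF]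
  constructor
  · intro h c' hc' hne
    have hmem : c ∈ {c | c ∈ C ∧ ∀ c' ∈ C, dist x c' ≤ dist x c} := h ▸ mem_singleton c
    by_contra! hle
    have : c' ∈ ({c} : Set (EuclideanSpace ℝ (Fin d))) := by
      rw [h]
      exact ⟨hc', fun b hb => (hmem.2 b hb).trans hle⟩
    exact hne this
  · intro h
    ext b
    simp only [mem_singleton_iff, mem_ofPred_eq]
    constructor
    · rintro rfl
      refine ⟨hc, fun c' hc' => ?_⟩
      by_cases hb : c' = b
      · rw [hb]
      · exact (h c' hc' hb).le
    · rintro ⟨hb, hmax⟩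
      by_contra hne
      exact (h b hb hne).not_ge (hmax c hc)

theorem isOpen_vorF_singleton {d : ℕ} {C : Set (EuclideanSpace ℝ (Fin d))} (hfin : C.Finite)
    {c : EuclideanSpace ℝ (Fin d)} (hc : c ∈ C) : IsOpen (vorF C {c}) := by
  have h : vorF C {c} = ⋂ c' ∈ C \ {c}, {x | dist x c' < dist x c} := by
    ext x
    simp [mem_vorF_singleton hc]
  rw [h]
  exact hfin.sdiff.isOpen_biInter fun c' _ => isOpen_lt (by fun_prop) (by fun_prop)

theorem setDim_of_isOpen {d : ℕ} {A : Set (EuclideanSpace ℝ (Fin d))} (hA : IsOpen A)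
    (hne : A.Nonempty) : setDim A = d := by
  rw [setDim, hA.affineSpan_eq_top hne, AffineSubspace.direction_top, finrank_top]
  simp

/-- In `r`-convex position, every center contributes a boundary point of `P_{C,r}` at which it is
the unique farthest center. -/
theorem vorF_singleton_inter_frontier_nonempty {d : ℕ} {C : Set (EuclideanSpace ℝ (Fin d))}
    {r : ℝ} (hr : 0 < r) (hC : RConvexPosition r C) {c : EuclideanSpace ℝ (Fin d)} (hc : c ∈ C) :
    (vorF C {c} ∩ frontier (ballPoly C r)).Nonempty := by
  obtain ⟨⟨p, hp⟩, hpos⟩ := hC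
  have hx := hpos c hc
  simp only [rConvexHull, mem_iInter, mem_ofPred_eq, not_forall, mem_closedBall, not_le] at hx
  obtain ⟨x, hx, hxc⟩ := hx
  obtain ⟨t, ht, hdist⟩ : ∃ t ∈ Icc (0 : ℝ) 1, dist (AffineMap.lineMap p x t) c = r := by
    have hcont : ContinuousOn (fun t : ℝ => dist (AffineMap.lineMap p x t) c) (Icc 0 1) :=
      (AffineMap.lineMap_continuous.dist continuous_const).continuousOn
    apply intermediate_value_Icc zero_le_one hcont
    simp only [AffineMap.lineMap_apply_zero, AffineMap.lineMap_apply_one]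
    exact ⟨(mem_ball'.1 (hp hc)).le, by rw [dist_comm]; exact hxc.le⟩
  have ht1 : t < 1 := by
    refine lt_of_le_of_ne ht.2 ?_
    rintro rfl
    rw [AffineMap.lineMap_apply_one, dist_comm] at hdist
    exact hxc.ne' hdist
  set y : EuclideanSpace ℝ (Fin d) := AffineMap.lineMap p x t with hy
  have hlt : ∀ c' ∈ C, c' ≠ c → dist y c' < r := by
    intro c' hc' hne
    have h1 : dist p c' < r := mem_ball'.1 (hp hc')
    have h2 : dist x c' ≤ r := mem_closedBall'.1 (hx ⟨hc', hne⟩)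
    have h3 : dist y c' ≤ (1 - t) * dist p c' + t * dist x c' := by
      have := (convexOn_univ_dist c').2 (mem_univ p) (mem_univ x) (sub_nonneg.2 ht.2) ht.1
        (sub_add_cancel 1 t)
      rwa [← AffineMap.lineMap_apply_module] at this
    nlinarith [ht.1]
  refine ⟨y, (mem_vorF_singleton hc).2 fun c' hc' hne => hdist ▸ hlt c' hc' hne, ?_⟩
  rw [frontier]
  refine ⟨subset_closure ?_, fun hint => ?_⟩
  · refine mem_iInter₂.2 fun c' hc' => mem_closedBall.2 ?_
    by_cases h : c' = c
    · rw [h, hdist]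
    · exact (hlt c' hc' h).le
  · have : y ∈ interior (closedBall c r) := interior_mono (biInter_subset_of_mem hc) hint
    rw [interior_closedBall c hr.ne', mem_ball, hdist] at this
    exact lt_irrefl r this

theorem eq_singleton_of_setDim_vorF {d : ℕ} {C S : Set (EuclideanSpace ℝ (Fin d))}
    (hfin : C.Finite) (hCne : C.Nonempty) (hne : (vorF C S).Nonempty)
    (hdim : setDim (vorF C S) = d) : ∃ c ∈ C, S = {c} := by
  obtain ⟨x, hx⟩ := hne
  obtain ⟨c, hc, hmax⟩ := hfin.exists_maximalFor (fun c => dist x c) C hCne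
  have hcS : c ∈ S := by
    rw [mem_vorF.1 hx]
    refine ⟨hc, fun c' hc' => ?_⟩
    by_contra! h
    exact h.not_ge (hmax hc' h.le)
  refine ⟨c, hc, eq_singleton_iff_unique_mem.2 ⟨hcS, fun b hb => ?_⟩⟩
  have hle : affineSpan ℝ (vorF C S) ≤ AffineSubspace.perpBisector c b := by
    refine affineSpan_le.2 fun y hy => AffineSubspace.mem_perpBisector_iff_dist_eq.2 ?_
    rw [mem_vorF.1 hy] at hcS hb
    exact le_antisymm (hb.2 c hcS.1) (hcS.2 b hb.1)
  have htop : affineSpan ℝ (vorF C S) = ⊤ := by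
    refine (AffineSubspace.direction_eq_top_iff_of_nonempty ⟨x, subset_affineSpan ℝ _ hx⟩).1 ?_
    refine Submodule.eq_top_of_finrank_eq ?_
    rw [finrank_euclideanSpace_fin]
    exact hdim
  have := AffineSubspace.mem_perpBisector_iff_dist_eq.1 (hle (htop ▸ AffineSubspace.mem_top ℝ _ c))
  rw [dist_self] at this
  exact (dist_eq_zero.1 this.symm).symm

/-- a basic `r`-ball polyhedron with `|C| = n` has exactly `n` facets, the
facets being the sets `V_{{c}} ∩ bd(P_{C,r})`, `c ∈ C`. -/
theorem stmt17 {d : ℕ} (hd : 2 ≤ d) (C : Set (EuclideanSpace ℝ (Fin d))) (r : ℝ)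
    (hC : IsBasicBallPolyhedron C r) (n : ℕ) (hn : d + 1 ≤ n) (hcard : C.ncard = n) :
    (∀ c ∈ C, (vorF C {c} ∩ frontier (ballPoly C r)).Nonempty ∧ setDim (vorF C {c}) = d) ∧
    (∀ S ⊆ C, (vorF C S ∩ frontier (ballPoly C r)).Nonempty → setDim (vorF C S) = d →
      ∃ c ∈ C, S = {c}) ∧
    fFace C r d = n := by
  obtain ⟨hr, hfin, -, -, -, -, hpos, -⟩ := hC
  have hCne : C.Nonempty := nonempty_of_ncard_ne_zero (by omega)
  have hfacet : ∀ c ∈ C, (vorF C {c} ∩ frontier (ballPoly C r)).Nonempty ∧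
      setDim (vorF C {c}) = d := fun c hc =>
    have h := vorF_singleton_inter_frontier_nonempty hr hpos hc
    ⟨h, setDim_of_isOpen (isOpen_vorF_singleton hfin hc) h.left⟩
  have hsingle : ∀ S ⊆ C, (vorF C S ∩ frontier (ballPoly C r)).Nonempty →
      setDim (vorF C S) = d → ∃ c ∈ C, S = {c} := fun S _ h hdim =>
    eq_singleton_of_setDim_vorF hfin hCne h.left hdim
  refine ⟨hfacet, hsingle, ?_⟩
  have himage : {S : Set (EuclideanSpace ℝ (Fin d)) | S ⊆ C ∧
      (vorF C S ∩ frontier (ballPoly C r)).Nonempty ∧ setDim (vorF C S) = d} =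
      (fun c => {c}) '' C := by
    ext S
    constructor
    · rintro ⟨hS, h, hdim⟩
      obtain ⟨c, hc, rfl⟩ := hsingle S hS h hdim
      exact ⟨c, hc, rfl⟩
    · rintro ⟨c, hc, rfl⟩
      exact ⟨singleton_subset_iff.2 hc, hfacet c hc⟩
  rw [fFace, himage, ncard_image_of_injective C singleton_injective, hcard]
end
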